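/- For every λ ∈ 𝔫*, the number of irreducible constituents of the supercharacter χ_λ of G (that is, |Irr(G, χ_λ)|) equals the number of coadjoint S_λ-orbits in the subset {ν restricted to 𝔰_λ : ν ∈ λG} of (𝔰_λ)*. -/

import Mathlib

open scoped Classical BigOperators ComplexOrder

set_option linter.unusedSectionVars false
set_option linter.unusedVariables false

noncomputable section

namespace IterChar

/-! ### Generic notions for finite groups: inner product, induction, characters -/

/-- The standard inner product `⟨f,h⟩_G = |G|⁻¹ ∑_{x ∈ G} f x * conj (h x)`. -/
def innerG (G : Type) [Group G] (f h : G → ℂ) : ℂ :=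
  (Nat.card G : ℂ)⁻¹ * ∑ᶠ x : G, f x * (starRingEnd ℂ) (h x)

/-- Induction of a function from a subgroup, via the Frobenius formula. -/
def indFun {G : Type} [Group G] (H : Subgroup G) (ψ : ↥H → ℂ) : G → ℂ :=
  fun g => (Nat.card ↥H : ℂ)⁻¹ *
    ∑ᶠ x : G, if h : x * g * x⁻¹ ∈ H then ψ ⟨x * g * x⁻¹, h⟩ else 0

/-- A function `G → ℂ` is a character if it is the trace character of some
finite-dimensional complex representation. -/
def IsCharacter (G : Type) [Group G] (f : G → ℂ) : Prop :=
  ∃ V : FDRep ℂ G, f = FDRep.character V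

/-- The set of irreducible characters of `G`: characters of norm one. -/
def Irr (G : Type) [Group G] : Set (G → ℂ) :=
  {f | IsCharacter G f ∧ innerG G f f = 1}

/-- The set of irreducible constituents of `χ`: irreducible characters with
`⟨χ, ψ⟩_G > 0` (using the complex partial order). -/
def IrrConstituents (G : Type) [Group G] (χ : G → ℂ) : Set (G → ℂ) :=
  {f | f ∈ Irr G ∧ 0 < innerG G χ f}

/-! ### Algebra groups -/

variable {F : Type} [Field F] [Fintype F] {R : Type} [Ring R] [Algebra F R] [Fintype R]

/-- `J` is a nilpotent (non-unital) subalgebra: all products of some fixed length vanish. -/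
def IsNil (J : NonUnitalSubalgebra F R) : Prop :=
  ∃ N : ℕ, ∀ l : List R, (∀ x ∈ l, x ∈ J) → l.length = N → l.prod = 0

/-- The algebra group `G = 1 + J` of a (nilpotent) subalgebra `J ⊆ R`, realized as the
subgroup of units `u` of `R` with `u - 1 ∈ J` (and `u⁻¹ - 1 ∈ J`, which is automatic
when `J` is nilpotent). -/
def algGroup (F : Type) [Field F] [Fintype F] (R : Type) [Ring R] [Algebra F R] [Fintype R]
    (J : NonUnitalSubalgebra F R) : Subgroup Rˣ where
  carrier := {u : Rˣ | ((u : R) - 1 ∈ J) ∧ (((u⁻¹ : Rˣ) : R) - 1 ∈ J)}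
  one_mem' := by
    constructor <;> · simp only [Units.val_one, inv_one, sub_self]; exact J.zero_mem
  mul_mem' := by
    rintro u v ⟨hu1, hu2⟩ ⟨hv1, hv2⟩
    constructor
    · have h : ((u * v : Rˣ) : R) - 1 =
          ((u : R) - 1) * ((v : R) - 1) + ((u : R) - 1) + ((v : R) - 1) := by
        push_cast; noncomm_ring
      rw [h]
      exact add_mem (add_mem (mul_mem hu1 hv1) hu1) hv1
    · have h : (((u * v)⁻¹ : Rˣ) : R) - 1 =
          (((v⁻¹ : Rˣ) : R) - 1) * (((u⁻¹ : Rˣ) : R) - 1) +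
            (((v⁻¹ : Rˣ) : R) - 1) + (((u⁻¹ : Rˣ) : R) - 1) := by
        rw [mul_inv_rev]; push_cast; noncomm_ring
      rw [h]
      exact add_mem (add_mem (mul_mem hv2 hu2) hv2) hu2
  inv_mem' := by
    rintro u ⟨h1, h2⟩
    exact ⟨h2, by simpa using h1⟩

theorem mem_algGroup {J : NonUnitalSubalgebra F R} {u : Rˣ} :
    u ∈ algGroup F R J ↔ ((u : R) - 1 ∈ J) ∧ (((u⁻¹ : Rˣ) : R) - 1 ∈ J) :=
  Iff.rfl

/-- The element `X ∈ J` such that `g = 1 + X`. -/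
def gElt {J : NonUnitalSubalgebra F R} (g : ↥(algGroup F R J)) : ↥J :=
  ⟨((g : Rˣ) : R) - 1, g.2.1⟩

/-- The function `θ_λ(1+X) = θ(λ(X))` on the algebra group `1 + J`. -/
def thetaFn (θ : AddChar F ℂ) (J : NonUnitalSubalgebra F R) (lam : ↥J →ₗ[F] F) :
    ↥(algGroup F R J) → ℂ :=
  fun g => θ (lam (gElt g))

/-- Left multiplication by the group element `g` as a linear endomorphism of `J`. -/
def lmulMap {J : NonUnitalSubalgebra F R} (g : ↥(algGroup F R J)) : ↥J →ₗ[F] ↥J where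
  toFun X := ⟨((g : Rˣ) : R) * (X : R), by
    have h : ((g : Rˣ) : R) * (X : R) = (((g : Rˣ) : R) - 1) * (X : R) + (X : R) := by
      noncomm_ring
    rw [h]; exact add_mem (mul_mem g.2.1 X.2) X.2⟩
  map_add' X Y := by ext; simp [mul_add]
  map_smul' c X := by ext; simp

/-- Right multiplication by the group element `g` as a linear endomorphism of `J`. -/
def rmulMap {J : NonUnitalSubalgebra F R} (g : ↥(algGroup F R J)) : ↥J →ₗ[F] ↥J where
  toFun X := ⟨(X : R) * ((g : Rˣ) : R), by
    have h : (X : R) * ((g : Rˣ) : R) = (X : R) * (((g : Rˣ) : R) - 1) + (X : R) := by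
      noncomm_ring
    rw [h]; exact add_mem (mul_mem X.2 g.2.1) X.2⟩
  map_add' X Y := by ext; simp [add_mul]
  map_smul' c X := by ext; simp

/-- The left action of `G` on the dual space: `(gλ)(X) = λ(g⁻¹ X)`. -/
def leftAct {J : NonUnitalSubalgebra F R} (g : ↥(algGroup F R J)) (lam : ↥J →ₗ[F] F) :
    ↥J →ₗ[F] F :=
  lam.comp (lmulMap g⁻¹)

/-- The right action of `G` on the dual space: `(λg)(X) = λ(X g⁻¹)`. -/
def rightAct {J : NonUnitalSubalgebra F R} (g : ↥(algGroup F R J)) (lam : ↥J →ₗ[F] F) :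
    ↥J →ₗ[F] F :=
  lam.comp (rmulMap g⁻¹)

/-- The coadjoint action of `G` on the dual space: `λ^g(X) = λ(g X g⁻¹)`. -/
def coAct {J : NonUnitalSubalgebra F R} (g : ↥(algGroup F R J)) (lam : ↥J →ₗ[F] F) :
    ↥J →ₗ[F] F :=
  lam.comp ((lmulMap g).comp (rmulMap g⁻¹))

/-- The left orbit `Gλ`. -/
def leftOrbit (J : NonUnitalSubalgebra F R) (lam : ↥J →ₗ[F] F) : Set (↥J →ₗ[F] F) :=
  Set.range fun g : ↥(algGroup F R J) => leftAct g lam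

/-- The right orbit `λG`. -/
def rightOrbit (J : NonUnitalSubalgebra F R) (lam : ↥J →ₗ[F] F) : Set (↥J →ₗ[F] F) :=
  Set.range fun g : ↥(algGroup F R J) => rightAct g lam

/-- The two-sided orbit `GλG`. -/
def twoOrbit (J : NonUnitalSubalgebra F R) (lam : ↥J →ₗ[F] F) : Set (↥J →ₗ[F] F) :=
  {mu | ∃ g h : ↥(algGroup F R J), mu = leftAct g (rightAct h lam)}

/-- The coadjoint orbit `λ^G`. -/
def coOrbit (J : NonUnitalSubalgebra F R) (lam : ↥J →ₗ[F] F) : Set (↥J →ₗ[F] F) :=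
  Set.range fun g : ↥(algGroup F R J) => coAct g lam

/-- The right orbit of `λ` under a subgroup `H` of the algebra group. -/
def rightOrbitUnder (J : NonUnitalSubalgebra F R) (H : Subgroup ↥(algGroup F R J))
    (lam : ↥J →ₗ[F] F) : Set (↥J →ₗ[F] F) :=
  {mu | ∃ s ∈ H, mu = rightAct s lam}

/-- The Kirillov function `ψ_λ = |λ^G|^{-1/2} ∑_{μ ∈ λ^G} θ_μ`. -/
def kirillov (θ : AddChar F ℂ) (J : NonUnitalSubalgebra F R) (lam : ↥J →ₗ[F] F) :
    ↥(algGroup F R J) → ℂ :=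
  fun g => ((Real.sqrt (Nat.card ↥(coOrbit J lam)) : ℂ))⁻¹ *
    ∑ᶠ mu ∈ coOrbit J lam, thetaFn θ J mu g

/-- The supercharacter `χ_λ = (|Gλ|/|GλG|) ∑_{μ ∈ GλG} θ_μ`. -/
def superchar (θ : AddChar F ℂ) (J : NonUnitalSubalgebra F R) (lam : ↥J →ₗ[F] F) :
    ↥(algGroup F R J) → ℂ :=
  fun g => ((Nat.card ↥(leftOrbit J lam) : ℂ) / (Nat.card ↥(twoOrbit J lam) : ℂ)) *
    ∑ᶠ mu ∈ twoOrbit J lam, thetaFn θ J mu g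

/-! ### The subalgebras `𝔩_λ`, `𝔰_λ` and their iterates -/

/-- The extension of `λ : J → F` by zero to all of `R`. -/
def lamE (J : NonUnitalSubalgebra F R) (lam : ↥J →ₗ[F] F) (x : R) : F :=
  if h : x ∈ J then lam ⟨x, h⟩ else 0

theorem lamE_apply (J : NonUnitalSubalgebra F R) (lam : ↥J →ₗ[F] F) {x : R} (hx : x ∈ J) :
    lamE J lam x = lam ⟨x, hx⟩ := dif_pos hx

theorem lamE_zero (J : NonUnitalSubalgebra F R) (lam : ↥J →ₗ[F] F) : lamE J lam 0 = 0 := by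
  rw [lamE_apply J lam J.zero_mem]
  have h : (⟨(0 : R), J.zero_mem⟩ : ↥J) = 0 := Subtype.ext rfl
  rw [h, map_zero]

theorem lamE_add (J : NonUnitalSubalgebra F R) (lam : ↥J →ₗ[F] F) {x y : R}
    (hx : x ∈ J) (hy : y ∈ J) : lamE J lam (x + y) = lamE J lam x + lamE J lam y := by
  rw [lamE, lamE, lamE, dif_pos (add_mem hx hy), dif_pos hx, dif_pos hy]
  have h : (⟨x + y, add_mem hx hy⟩ : ↥J) = ⟨x, hx⟩ + ⟨y, hy⟩ := Subtype.ext rfl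
  rw [h, map_add]

theorem lamE_smul (J : NonUnitalSubalgebra F R) (lam : ↥J →ₗ[F] F) (c : F) {x : R}
    (hx : x ∈ J) : lamE J lam (c • x) = c * lamE J lam x := by
  rw [lamE, lamE, dif_pos (SMulMemClass.smul_mem c hx), dif_pos hx]
  have h : (⟨c • x, SMulMemClass.smul_mem c hx⟩ : ↥J) = c • ⟨x, hx⟩ := Subtype.ext rfl
  rw [h, map_smul]
  rfl

/-- The left kernel `𝔩` of the bilinear form `(X,Y) ↦ λ(XY)` restricted to `s × s`. -/
def lStep (J : NonUnitalSubalgebra F R) (lam : ↥J →ₗ[F] F)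
    (s : NonUnitalSubalgebra F R) (hs : s ≤ J) : NonUnitalSubalgebra F R where
  carrier := {x | x ∈ s ∧ ∀ y ∈ s, lamE J lam (x * y) = 0}
  zero_mem' := ⟨zero_mem s, fun y _ => by rw [zero_mul, lamE_zero]⟩
  add_mem' := by
    rintro a b ⟨ha1, ha2⟩ ⟨hb1, hb2⟩
    refine ⟨add_mem ha1 hb1, fun y hy => ?_⟩
    rw [add_mul, lamE_add J lam (J.mul_mem (hs ha1) (hs hy)) (J.mul_mem (hs hb1) (hs hy)),
      ha2 y hy, hb2 y hy, add_zero]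
  smul_mem' := by
    rintro c a ⟨ha1, ha2⟩
    refine ⟨SMulMemClass.smul_mem c ha1, fun y hy => ?_⟩
    rw [smul_mul_assoc, lamE_smul J lam c (J.mul_mem (hs ha1) (hs hy)), ha2 y hy, mul_zero]
  mul_mem' := by
    rintro a b ⟨ha1, ha2⟩ ⟨hb1, hb2⟩
    refine ⟨mul_mem ha1 hb1, fun y hy => ?_⟩
    rw [mul_assoc]
    exact ha2 (b * y) (mul_mem hb1 hy)

theorem lStep_le (J : NonUnitalSubalgebra F R) (lam : ↥J →ₗ[F] F)
    (s : NonUnitalSubalgebra F R) (hs : s ≤ J) : lStep J lam s hs ≤ s :=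
  fun _ hx => hx.1

/-- The left kernel `𝔰` of the bilinear form `(X,Y) ↦ λ(XY)` restricted to `s × 𝔩`. -/
def sStep (J : NonUnitalSubalgebra F R) (lam : ↥J →ₗ[F] F)
    (s : NonUnitalSubalgebra F R) (hs : s ≤ J) : NonUnitalSubalgebra F R where
  carrier := {x | x ∈ s ∧ ∀ y ∈ lStep J lam s hs, lamE J lam (x * y) = 0}
  zero_mem' := ⟨zero_mem s, fun y _ => by rw [zero_mul, lamE_zero]⟩
  add_mem' := by
    rintro a b ⟨ha1, ha2⟩ ⟨hb1, hb2⟩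
    refine ⟨add_mem ha1 hb1, fun y hy => ?_⟩
    rw [add_mul, lamE_add J lam (J.mul_mem (hs ha1) (hs hy.1)) (J.mul_mem (hs hb1) (hs hy.1)),
      ha2 y hy, hb2 y hy, add_zero]
  smul_mem' := by
    rintro c a ⟨ha1, ha2⟩
    refine ⟨SMulMemClass.smul_mem c ha1, fun y hy => ?_⟩
    rw [smul_mul_assoc, lamE_smul J lam c (J.mul_mem (hs ha1) (hs hy.1)), ha2 y hy, mul_zero]
  mul_mem' := by
    rintro a b ⟨ha1, ha2⟩ ⟨hb1, hb2⟩
    refine ⟨mul_mem ha1 hb1, fun y hy => ?_⟩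
    rw [mul_assoc]
    refine ha2 (b * y) ⟨mul_mem hb1 hy.1, fun z hz => ?_⟩
    rw [mul_assoc]
    refine hb2 (y * z) ⟨mul_mem hy.1 hz, fun w hw => ?_⟩
    rw [mul_assoc]
    exact hy.2 (z * w) (mul_mem hz hw)

theorem sStep_le (J : NonUnitalSubalgebra F R) (lam : ↥J →ₗ[F] F)
    (s : NonUnitalSubalgebra F R) (hs : s ≤ J) : sStep J lam s hs ≤ s :=
  fun _ hx => hx.1

/-- `𝔩_λ`: the left kernel of `(X,Y) ↦ λ(XY)` on `J × J`. -/
def lone (J : NonUnitalSubalgebra F R) (lam : ↥J →ₗ[F] F) : NonUnitalSubalgebra F R :=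
  lStep J lam J le_rfl

/-- `𝔰_λ`: the left kernel of `(X,Y) ↦ λ(XY)` on `J × 𝔩_λ`. -/
def sone (J : NonUnitalSubalgebra F R) (lam : ↥J →ₗ[F] F) : NonUnitalSubalgebra F R :=
  sStep J lam J le_rfl

theorem lone_le (J : NonUnitalSubalgebra F R) (lam : ↥J →ₗ[F] F) : lone J lam ≤ J :=
  lStep_le J lam J le_rfl

theorem sone_le (J : NonUnitalSubalgebra F R) (lam : ↥J →ₗ[F] F) : sone J lam ≤ J :=
  sStep_le J lam J le_rfl

/-- `𝔨_λ = 𝔩_λ ∩ ker λ`. -/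
def kone (J : NonUnitalSubalgebra F R) (lam : ↥J →ₗ[F] F) : NonUnitalSubalgebra F R where
  carrier := {x | x ∈ lone J lam ∧ lamE J lam x = 0}
  zero_mem' := ⟨zero_mem _, lamE_zero J lam⟩
  add_mem' := by
    rintro a b ⟨ha1, ha2⟩ ⟨hb1, hb2⟩
    exact ⟨add_mem ha1 hb1, by
      rw [lamE_add J lam (lone_le J lam ha1) (lone_le J lam hb1), ha2, hb2, add_zero]⟩
  smul_mem' := by
    rintro c a ⟨ha1, ha2⟩
    exact ⟨SMulMemClass.smul_mem c ha1, by
      rw [lamE_smul J lam c (lone_le J lam ha1), ha2, mul_zero]⟩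
  mul_mem' := by
    rintro a b ⟨ha1, ha2⟩ ⟨hb1, hb2⟩
    exact ⟨mul_mem ha1 hb1, ha1.2 b (lone_le J lam hb1)⟩

theorem kone_le (J : NonUnitalSubalgebra F R) (lam : ↥J →ₗ[F] F) : kone J lam ≤ lone J lam :=
  fun _ hx => hx.1

/-- The descending chain `𝔰_λ^0 ⊇ 𝔰_λ^1 ⊇ ⋯` (bundled with the proof `𝔰_λ^i ≤ J`). -/
def sChainAux (J : NonUnitalSubalgebra F R) (lam : ↥J →ₗ[F] F) :
    ℕ → {s : NonUnitalSubalgebra F R // s ≤ J}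
  | 0 => ⟨J, le_rfl⟩
  | n + 1 =>
    ⟨sStep J lam (sChainAux J lam n).1 (sChainAux J lam n).2,
      le_trans (sStep_le J lam (sChainAux J lam n).1 (sChainAux J lam n).2)
        (sChainAux J lam n).2⟩

/-- `𝔰_λ^i`. -/
def sChain (J : NonUnitalSubalgebra F R) (lam : ↥J →ₗ[F] F) (i : ℕ) :
    NonUnitalSubalgebra F R :=
  (sChainAux J lam i).1

/-- `𝔩_λ^{i+1}`. -/
def lChain (J : NonUnitalSubalgebra F R) (lam : ↥J →ₗ[F] F) (i : ℕ) :
    NonUnitalSubalgebra F R :=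
  lStep J lam (sChainAux J lam i).1 (sChainAux J lam i).2

/-- The terminal element `𝔰̄_λ` of the descending chain; the chain has stabilized by
stage `|R|` since it is a weakly decreasing chain of subalgebras of the finite algebra. -/
def sbar (J : NonUnitalSubalgebra F R) (lam : ↥J →ₗ[F] F) : NonUnitalSubalgebra F R :=
  sChain J lam (Fintype.card R)

theorem sbar_le (J : NonUnitalSubalgebra F R) (lam : ↥J →ₗ[F] F) : sbar J lam ≤ J :=
  (sChainAux J lam (Fintype.card R)).2

/-- The terminal element `𝔩̄_λ` of the ascending chain. -/
def lbar (J : NonUnitalSubalgebra F R) (lam : ↥J →ₗ[F] F) : NonUnitalSubalgebra F R :=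
  lStep J lam (sbar J lam) (sbar_le J lam)

theorem lbar_le (J : NonUnitalSubalgebra F R) (lam : ↥J →ₗ[F] F) : lbar J lam ≤ J :=
  le_trans (lStep_le J lam _ _) (sbar_le J lam)

/-! ### Algebra subgroups of an algebra group -/

/-- The algebra subgroup `1 + k` of `1 + J`, as a subgroup of the ambient algebra group. -/
def algSubgroup (k J : NonUnitalSubalgebra F R) : Subgroup ↥(algGroup F R J) :=
  (algGroup F R k).subgroupOf (algGroup F R J)

/-- `L_λ = 1 + 𝔩_λ` as a subgroup of `G`. -/
def Lgrp (J : NonUnitalSubalgebra F R) (lam : ↥J →ₗ[F] F) : Subgroup ↥(algGroup F R J) :=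
  algSubgroup (lone J lam) J

/-- `S_λ = 1 + 𝔰_λ` as a subgroup of `G`. -/
def Sgrp (J : NonUnitalSubalgebra F R) (lam : ↥J →ₗ[F] F) : Subgroup ↥(algGroup F R J) :=
  algSubgroup (sone J lam) J

/-- `L̄_λ = 1 + 𝔩̄_λ` as a subgroup of `G`. -/
def Lbarg (J : NonUnitalSubalgebra F R) (lam : ↥J →ₗ[F] F) : Subgroup ↥(algGroup F R J) :=
  algSubgroup (lbar J lam) J

/-- `S̄_λ = 1 + 𝔰̄_λ` as a subgroup of `G`. -/
def Sbarg (J : NonUnitalSubalgebra F R) (lam : ↥J →ₗ[F] F) : Subgroup ↥(algGroup F R J) :=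
  algSubgroup (sbar J lam) J

/-- Passing from an element of the subgroup `1 + k ≤ 1 + J` to an element of the
algebra group `1 + k` in its own right. -/
def toAlg {k J : NonUnitalSubalgebra F R} (x : ↥(algSubgroup k J)) : ↥(algGroup F R k) :=
  ⟨((x : ↥(algGroup F R J)) : Rˣ), Subgroup.mem_subgroupOf.mp x.2⟩

/-- The linear inclusion of a smaller subalgebra. -/
def inclMap {s J : NonUnitalSubalgebra F R} (h : s ≤ J) : ↥s →ₗ[F] ↥J where
  toFun x := ⟨(x : R), h x.2⟩
  map_add' x y := rfl
  map_smul' c x := rfl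

/-- Restriction of a functional on `J` to a smaller subalgebra. -/
def resTo {s J : NonUnitalSubalgebra F R} (h : s ≤ J) (lam : ↥J →ₗ[F] F) : ↥s →ₗ[F] F :=
  lam.comp (inclMap h)

/-- The character `ξ_λ = Ind_{L̄_λ}^G (θ_λ)`. -/
def xi (θ : AddChar F ℂ) (J : NonUnitalSubalgebra F R) (lam : ↥J →ₗ[F] F) :
    ↥(algGroup F R J) → ℂ :=
  indFun (Lbarg J lam) (fun x => thetaFn θ J lam ↑x)

/-- The set `Ξ_λ = {g λ s g⁻¹ : g ∈ G, s ∈ S̄_λ}`. -/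
def Xi (J : NonUnitalSubalgebra F R) (lam : ↥J →ₗ[F] F) : Set (↥J →ₗ[F] F) :=
  {nu | ∃ g : ↥(algGroup F R J), ∃ s ∈ Sbarg J lam, nu = coAct g (rightAct s lam)}

/-! ### Normality of algebra subgroups coming from ideals -/

theorem conj_mem_aux (s a : NonUnitalSubalgebra F R)
    (hl : ∀ x ∈ s, ∀ y ∈ a, x * y ∈ a) (hr : ∀ y ∈ a, ∀ x ∈ s, y * x ∈ a)
    (u : Rˣ) (hu1 : (u : R) - 1 ∈ s) (hu2 : ((u⁻¹ : Rˣ) : R) - 1 ∈ s)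
    (x : Rˣ) (hx : (x : R) - 1 ∈ a) : ((u * x * u⁻¹ : Rˣ) : R) - 1 ∈ a := by
  have h1 : (u : R) * ((u⁻¹ : Rˣ) : R) = 1 := Units.mul_inv u
  have key : ((u * x * u⁻¹ : Rˣ) : R) - 1 =
      ((u : R) - 1) * ((x : R) - 1) * (((u⁻¹ : Rˣ) : R) - 1) +
        ((u : R) - 1) * ((x : R) - 1) + ((x : R) - 1) * (((u⁻¹ : Rˣ) : R) - 1) +
        ((x : R) - 1) := by
    push_cast
    calc (u : R) * (x : R) * ((u⁻¹ : Rˣ) : R) - 1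
        = (u : R) * (x : R) * ((u⁻¹ : Rˣ) : R) - (u : R) * ((u⁻¹ : Rˣ) : R) := by rw [h1]
      _ = _ := by noncomm_ring
  rw [key]
  exact add_mem (add_mem (add_mem (hr _ (hl _ hu1 _ hx) _ hu2) (hl _ hu1 _ hx))
    (hr _ hx _ hu2)) hx

theorem algSubgroup_normal (s a : NonUnitalSubalgebra F R)
    (hl : ∀ x ∈ s, ∀ y ∈ a, x * y ∈ a) (hr : ∀ y ∈ a, ∀ x ∈ s, y * x ∈ a) :
    ((algGroup F R a).subgroupOf (algGroup F R s)).Normal := by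
  constructor
  intro n hn g
  rw [Subgroup.mem_subgroupOf] at hn ⊢
  have hginv : ((g⁻¹ : ↥(algGroup F R s)) : Rˣ) = ((g : Rˣ))⁻¹ := rfl
  have hcoe : ((g * n * g⁻¹ : ↥(algGroup F R s)) : Rˣ) = (g : Rˣ) * (n : Rˣ) * ((g : Rˣ))⁻¹ := by
    push_cast [hginv]; rfl
  rw [mem_algGroup]
  constructor
  · rw [hcoe]
    exact conj_mem_aux s a hl hr (g : Rˣ) (g : ↥(algGroup F R s)).2.1 (g : ↥(algGroup F R s)).2.2
      (n : Rˣ) hn.1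
  · have hinv : (((g * n * g⁻¹ : ↥(algGroup F R s)) : Rˣ))⁻¹ =
        (g : Rˣ) * ((n : Rˣ))⁻¹ * ((g : Rˣ))⁻¹ := by
      rw [hcoe]; group
    rw [hinv]
    exact conj_mem_aux s a hl hr (g : Rˣ) (g : ↥(algGroup F R s)).2.1 (g : ↥(algGroup F R s)).2.2
      ((n : Rˣ))⁻¹ hn.2

theorem lone_mul_mem (J : NonUnitalSubalgebra F R) (lam : ↥J →ₗ[F] F)
    {y z : R} (hy : y ∈ lone J lam) (hz : z ∈ J) : y * z ∈ lone J lam := by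
  refine ⟨J.mul_mem (lone_le J lam hy) hz, fun w hw => ?_⟩
  rw [mul_assoc]
  exact hy.2 (z * w) (J.mul_mem hz hw)

theorem sone_mul_lone_mem (J : NonUnitalSubalgebra F R) (lam : ↥J →ₗ[F] F)
    {x y : R} (hx : x ∈ sone J lam) (hy : y ∈ lone J lam) : x * y ∈ lone J lam := by
  refine ⟨J.mul_mem (sone_le J lam hx) (lone_le J lam hy), fun w hw => ?_⟩
  rw [mul_assoc]
  exact hx.2 (y * w) (lone_mul_mem J lam hy hw)

theorem kone_ideal_left (J : NonUnitalSubalgebra F R) (lam : ↥J →ₗ[F] F) :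
    ∀ x ∈ sone J lam, ∀ y ∈ kone J lam, x * y ∈ kone J lam := by
  intro x hx y hy
  exact ⟨sone_mul_lone_mem J lam hx hy.1, hx.2 y hy.1⟩

theorem kone_ideal_right (J : NonUnitalSubalgebra F R) (lam : ↥J →ₗ[F] F) :
    ∀ y ∈ kone J lam, ∀ x ∈ sone J lam, y * x ∈ kone J lam := by
  intro y hy x hx
  exact ⟨lone_mul_mem J lam hy.1 (sone_le J lam hx), hy.1.2 x (sone_le J lam hx)⟩

/-- `K_λ = 1 + 𝔨_λ` as a (normal) subgroup of `S_λ = 1 + 𝔰_λ`. -/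
def KgrpIn (J : NonUnitalSubalgebra F R) (lam : ↥J →ₗ[F] F) :
    Subgroup ↥(algGroup F R (sone J lam)) :=
  (algGroup F R (kone J lam)).subgroupOf (algGroup F R (sone J lam))

instance KgrpIn_normal (J : NonUnitalSubalgebra F R) (lam : ↥J →ₗ[F] F) :
    (KgrpIn J lam).Normal :=
  algSubgroup_normal (sone J lam) (kone J lam) (kone_ideal_left J lam) (kone_ideal_right J lam)

/-- `L_λ = 1 + 𝔩_λ` as a (normal) subgroup of `S_λ = 1 + 𝔰_λ`. -/
def LgrpIn (J : NonUnitalSubalgebra F R) (lam : ↥J →ₗ[F] F) :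
    Subgroup ↥(algGroup F R (sone J lam)) :=
  (algGroup F R (lone J lam)).subgroupOf (algGroup F R (sone J lam))

instance LgrpIn_normal (J : NonUnitalSubalgebra F R) (lam : ↥J →ₗ[F] F) :
    (LgrpIn J lam).Normal :=
  algSubgroup_normal (sone J lam) (lone J lam)
    (fun x hx y hy => sone_mul_lone_mem J lam hx hy)
    (fun y hy x hx => lone_mul_mem J lam hy (sone_le J lam hx))

/-! ### Characters of finite groups -/

section FiniteGroup

open Representation

variable {G : Type} [Group G] [Fintype G]

theorem innerG_eq_sum (f h : G → ℂ) :
    innerG G f h = (Nat.card G : ℂ)⁻¹ * ∑ x : G, f x * (starRingEnd ℂ) (h x) := by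
  rw [innerG, finsum_eq_sum_of_fintype]

theorem character_inv {V : Type} [AddCommGroup V] [Module ℂ V] [FiniteDimensional ℂ V]
    (ρ : Representation ℂ G V) (g : G) :
    ρ.character g⁻¹ = (starRingEnd ℂ) (ρ.character g) := by
  let b := Module.finBasis ℂ V
  let M : G → Matrix _ _ ℂ := fun g => LinearMap.toMatrix b b (ρ g)
  have hM : ∀ x y, M (x * y) = M x * M y := fun x y => by
    simp only [M, map_mul, LinearMap.toMatrix_mul]
  have hM1 : M 1 = 1 := by simp [M]
  have htr : ∀ x, ρ.character x = (M x).trace := fun x =>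
    LinearMap.trace_eq_matrix_trace ℂ b (ρ x)
  let H : Matrix _ _ ℂ := ∑ x : G, (M x).conjTranspose * M x
  have hpos : H.PosDef := by
    refine Matrix.posDef_sum ⟨1, Finset.mem_univ _⟩ fun x _ => ?_
    refine Matrix.PosDef.conjTranspose_mul_self _ ?_
    refine Function.LeftInverse.injective (g := (M x⁻¹).mulVec) fun v => ?_
    rw [Matrix.mulVec_mulVec, ← hM, inv_mul_cancel, hM1, Matrix.one_mulVec]
  have hinv : (M g).conjTranspose * H * M g = H := by
    simp only [H, Finset.mul_sum, Finset.sum_mul]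
    refine Fintype.sum_equiv (Equiv.mulRight g) _ _ fun x => ?_
    simp only [Equiv.coe_mulRight, hM, Matrix.conjTranspose_mul, Matrix.mul_assoc]
  have hu : IsUnit H.det := (Matrix.isUnit_iff_isUnit_det _).1 hpos.isUnit
  have h1 : H * M g⁻¹ = (M g).conjTranspose * H := by
    calc H * M g⁻¹ = (M g).conjTranspose * H * M g * M g⁻¹ := by rw [hinv]
      _ = _ := by rw [Matrix.mul_assoc, ← hM, mul_inv_cancel, hM1, Matrix.mul_one]
  have h2 : M g⁻¹ = H⁻¹ * ((M g).conjTranspose * H) := by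
    rw [← h1, Matrix.nonsing_inv_mul_cancel_left _ _ hu]
  rw [htr, htr, h2, Matrix.trace_mul_comm, Matrix.mul_assoc, Matrix.mul_nonsing_inv _ hu,
    Matrix.mul_one, Matrix.trace_conjTranspose]
  rfl

theorem card_ne_zero' : (Nat.card G : ℂ) ≠ 0 := by
  simp [Nat.card_eq_fintype_card]

theorem innerG_character_eq_finrank {V W : Type} [AddCommGroup V] [Module ℂ V]
    [FiniteDimensional ℂ V] [AddCommGroup W] [Module ℂ W] [FiniteDimensional ℂ W]
    (ρ : Representation ℂ G V) (σ : Representation ℂ G W) :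
    innerG G σ.character ρ.character = Module.finrank ℂ (IntertwiningMap ρ σ) := by
  have := invertibleOfNonzero (card_ne_zero' (G := G))
  rw [innerG_eq_sum, ← card_inv_mul_sum_char_mul_char_eq_finrank]
  simp only [character_inv]

theorem exists_simple_of_mem_irr {ψ : G → ℂ} (h : ψ ∈ Irr G) :
    ∃ V : FDRep ℂ G, CategoryTheory.Simple V ∧ ψ = V.character := by
  obtain ⟨⟨V, rfl⟩, hV⟩ := h
  refine ⟨V, ?_, rfl⟩
  rw [FDRep.simple_iff_char_is_norm_one]
  rw [innerG_eq_sum, inv_mul_eq_one₀ card_ne_zero'] at hV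
  rw [hV]
  exact Finset.sum_congr rfl fun g _ => congrArg _ (character_inv V.ρ g)

theorem innerG_irr {ψ φ : G → ℂ} (hψ : ψ ∈ Irr G) (hφ : φ ∈ Irr G) :
    innerG G ψ φ = if ψ = φ then 1 else 0 := by
  split_ifs with h
  · subst h; exact hψ.2
  · obtain ⟨V, hV, rfl⟩ := exists_simple_of_mem_irr hψ
    obtain ⟨W, hW, rfl⟩ := exists_simple_of_mem_irr hφ
    have := invertibleOfNonzero (card_ne_zero' (G := G))
    have key := FDRep.char_orthonormal V W
    rw [if_neg fun ⟨i⟩ => h (FDRep.char_iso i)] at key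
    rw [← key, innerG_eq_sum]
    congr 1
    exact Finset.sum_congr rfl fun g _ => congrArg _ (character_inv W.ρ g).symm

/-- The operator `∑ c(g) ρ(g)` attached to a function `c` on the group. -/
def weightedSum {V : Type} [AddCommGroup V] [Module ℂ V] (ρ : Representation ℂ G V)
    (c : G → ℂ) : V →ₗ[ℂ] V :=
  ∑ g : G, c g • ρ g

theorem weightedSum_comm {V : Type} [AddCommGroup V] [Module ℂ V] (ρ : Representation ℂ G V)
    {c : G → ℂ} (hc : ∀ g h, c (h * g * h⁻¹) = c g) (h : G) :
    weightedSum ρ c * ρ h = ρ h * weightedSum ρ c := by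
  simp only [weightedSum, Finset.sum_mul, Finset.mul_sum, smul_mul_assoc, mul_smul_comm,
    ← map_mul]
  refine Fintype.sum_equiv (MulAut.conj h⁻¹).toEquiv _ _ fun g => ?_
  have : c (h⁻¹ * g * h) = c g := by simpa using hc g h⁻¹
  simp [this, ← mul_assoc]

theorem trace_weightedSum_mul {V : Type} [AddCommGroup V] [Module ℂ V]
    (ρ : Representation ℂ G V) (c : G → ℂ) (h : G) :
    LinearMap.trace ℂ V (ρ h * weightedSum ρ c) = ∑ g : G, c g * ρ.character (h * g) := by
  simp [weightedSum, Finset.mul_sum, ← map_mul, Representation.character]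

theorem weightedSum_eq_smul {V : Type} [AddCommGroup V] [Module ℂ V] [FiniteDimensional ℂ V]
    (ρ : Representation ℂ G V) (hρ : innerG G ρ.character ρ.character = 1)
    {c : G → ℂ} (hc : ∀ g h, c (h * g * h⁻¹) = c g) :
    ∃ ω : ℂ, weightedSum ρ c = ω • (1 : V →ₗ[ℂ] V) := by
  rw [innerG_character_eq_finrank] at hρ
  have hfr : Module.finrank ℂ (IntertwiningMap ρ ρ) = 1 := by exact_mod_cast hρ
  let T : IntertwiningMap ρ ρ := ⟨weightedSum ρ c, fun h => weightedSum_comm ρ hc h⟩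
  have hid : IntertwiningMap.id ρ ≠ 0 := by
    intro h0
    have : ∀ f : IntertwiningMap ρ ρ, f = 0 := fun f => by
      apply IntertwiningMap.ext
      ext v
      have hv : v = 0 := DFunLike.congr_fun h0 v
      simp [hv]
    have : Subsingleton (IntertwiningMap ρ ρ) := ⟨fun a b => (this a).trans (this b).symm⟩
    rw [Module.finrank_zero_of_subsingleton] at hfr
    exact zero_ne_one hfr
  obtain ⟨ω, hω⟩ := (finrank_eq_one_iff_of_nonzero' _ hid).1 hfr T
  exact ⟨ω, LinearMap.ext fun v => (DFunLike.congr_fun hω v).symm⟩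

theorem character_mem_irr {V : Type} [AddCommGroup V] [Module ℂ V] [FiniteDimensional ℂ V]
    (ρ : Representation ℂ G V) (hρ : ρ.IsIrreducible) : ρ.character ∈ Irr G := by
  refine ⟨⟨FDRep.of ρ, rfl⟩, ?_⟩
  rw [innerG_character_eq_finrank, IsIrreducible.finrank_intertwiningMap_self, Nat.cast_one]

/-- A class function orthogonal to all irreducible characters acts as zero on every
representation. -/
theorem weightedSum_eq_zero {c : G → ℂ} (hc : ∀ g h, c (h * g * h⁻¹) = c g)
    (hort : ∀ ψ ∈ Irr G, ∑ g : G, c g * ψ g = 0) (n : ℕ) :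
    ∀ (V : Type) [AddCommGroup V] [Module ℂ V] [FiniteDimensional ℂ V]
      (ρ : Representation ℂ G V), Module.finrank ℂ V = n → weightedSum ρ c = 0 := by
  induction n using Nat.strong_induction_on with
  | _ n ih =>
  intro V _ _ _ ρ hn
  by_cases hirr : ρ.IsIrreducible
  · have hmem := character_mem_irr ρ hirr
    obtain ⟨ω, hω⟩ := weightedSum_eq_smul ρ hmem.2 hc
    have htr := trace_weightedSum_mul ρ c 1
    simp only [one_mul, map_one, hort _ hmem, hω, map_smul, LinearMap.trace_one,
      smul_eq_mul, mul_eq_zero, Nat.cast_eq_zero] at htr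
    rcases htr with h | h
    · rw [hω, h, zero_smul]
    · have := Module.finrank_zero_iff.1 h
      exact Subsingleton.elim _ _
  · by_cases htriv : Subsingleton V
    · exact Subsingleton.elim _ _
    rw [not_subsingleton_iff_nontrivial] at htriv
    have hnt : Nontrivial (Subrepresentation ρ) := by
      refine ⟨⊥, ⊤, fun h => ?_⟩
      have : (⊥ : Submodule ℂ V) = ⊤ := congrArg Subrepresentation.toSubmodule h
      exact bot_ne_top this
    obtain ⟨W, hW0, hW1⟩ : ∃ W : Subrepresentation ρ, W ≠ ⊥ ∧ W ≠ ⊤ := by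
      by_contra! hcon
      exact hirr ⟨fun W => or_iff_not_imp_left.2 (hcon W)⟩
    obtain ⟨W', hWW'⟩ := exists_isCompl W
    have hW'1 : W' ≠ ⊤ := by
      rintro rfl
      exact hW0 (by simpa using hWW'.inf_eq_bot)
    have hzero : ∀ U : Subrepresentation ρ, U ≠ ⊤ → ∀ v ∈ U.toSubmodule,
        weightedSum ρ c v = 0 := by
      intro U hU v hv
      have hlt : Module.finrank ℂ U.toSubmodule < n := by
        rw [← hn]
        refine Submodule.finrank_lt fun h => hU ?_
        exact Subrepresentation.toSubmodule_injective h
      have h0 := LinearMap.congr_fun (ih _ hlt U.toSubmodule U.toRepresentation rfl) ⟨v, hv⟩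
      have h1 := congrArg Subtype.val h0
      simpa [weightedSum, Subrepresentation.toRepresentation] using h1
    ext v
    have hv : v ∈ W.toSubmodule ⊔ W'.toSubmodule := by
      rw [← Subrepresentation.toSubmodule_sup, hWW'.sup_eq_top]
      exact Submodule.mem_top
    obtain ⟨w, hw, w', hw', rfl⟩ := Submodule.mem_sup.1 hv
    simp [hzero W hW1 w hw, hzero W' hW'1 w' hw']

theorem eq_zero_of_orthogonal {c : G → ℂ} (hc : ∀ g h, c (h * g * h⁻¹) = c g)
    (hort : ∀ ψ ∈ Irr G, ∑ g : G, c g * ψ g = 0) : c = 0 := by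
  have h := weightedSum_eq_zero hc hort _ (MonoidAlgebra ℂ G) (Representation.leftRegular ℂ G) rfl
  have h1 := LinearMap.congr_fun h (MonoidAlgebra.single 1 1)
  funext g
  have h2 := congrArg (fun f : MonoidAlgebra ℂ G => f.coeff g) h1
  simpa [weightedSum, Finsupp.single_apply] using h2

end FiniteGroup

/-! ### Irreducible characters lying over a linear character of a subgroup -/

section Over

variable {G : Type} [Group G] [Fintype G]

theorem class_mem_span_irr {f : G → ℂ} (hf : ∀ g h, f (h * g * h⁻¹) = f g) :
    f ∈ Submodule.span ℂ (Irr G) := by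
  have hli : LinearIndependent ℂ ((↑) : Irr G → G → ℂ) := by
    rw [linearIndependent_iff']
    intro s c hc i hi
    have h1 : innerG G (∑ j ∈ s, c j • (j : G → ℂ)) i = c i := by
      have : innerG G (∑ j ∈ s, c j • (j : G → ℂ)) i = ∑ j ∈ s, c j * innerG G j i := by
        simp only [innerG_eq_sum, Finset.sum_apply, Pi.smul_apply, smul_eq_mul, Finset.sum_mul,
          Finset.mul_sum]
        rw [Finset.sum_comm]
        exact Finset.sum_congr rfl fun _ _ => Finset.sum_congr rfl fun _ _ => by ring
      rw [this, Finset.sum_eq_single_of_mem i hi, i.2.2, mul_one]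
      intro j _ hj
      rw [innerG_irr j.2 i.2, if_neg fun h => hj (Subtype.ext h), mul_zero]
    rw [← h1, hc]
    simp [innerG_eq_sum]
  have hfin : Finite (Irr G) := hli.finite
  have := Fintype.ofFinite (Irr G)
  let p : G → ℂ := f - ∑ j : Irr G, innerG G f j • (j : G → ℂ)
  have hp : p = 0 := by
    have hcl : ∀ g h, p (h * g * h⁻¹) = p g := by
      intro g h
      have hj : ∀ j : Irr G, (j : G → ℂ) (h * g * h⁻¹) = (j : G → ℂ) g := by
        intro j
        obtain ⟨⟨V, hV⟩, -⟩ := j.2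
        rw [hV, FDRep.char_conj]
      simp [p, hf, hj]
    have h0 : (fun g => (starRingEnd ℂ) (p g)) = 0 := by
      refine eq_zero_of_orthogonal (fun g h => by rw [hcl]) fun ψ hψ => ?_
      have hin : innerG G p ψ = 0 := by
        have : ∀ c : Irr G → ℂ, innerG G (f - ∑ j : Irr G, c j • (j : G → ℂ)) ψ =
            innerG G f ψ - ∑ j : Irr G, c j * innerG G (j : G → ℂ) ψ := by
          intro c
          simp only [innerG_eq_sum, Pi.sub_apply, Finset.sum_apply, Pi.smul_apply, smul_eq_mul,
            sub_mul, Finset.sum_sub_distrib, mul_sub, Finset.sum_mul, Finset.mul_sum]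
          congr 1
          rw [Finset.sum_comm]
          exact Finset.sum_congr rfl fun _ _ => Finset.sum_congr rfl fun _ _ => by ring
        rw [this, Finset.sum_eq_single_of_mem (⟨ψ, hψ⟩ : Irr G) (Finset.mem_univ _), hψ.2]
        · simp
        · intro j _ hj
          rw [innerG_irr j.2 hψ, if_neg fun h => hj (Subtype.ext h), mul_zero]
      rw [innerG_eq_sum, mul_eq_zero] at hin
      have h2 := congrArg (starRingEnd ℂ) (hin.resolve_left (inv_ne_zero card_ne_zero'))
      simpa using h2
    funext g
    have := congrFun h0 g
    simpa using this
  rw [sub_eq_zero.1 hp]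
  exact Submodule.sum_mem _ fun j _ => Submodule.smul_mem _ _ (Submodule.subset_span j.2)

/-- The functions on `G` supported on `S`, invariant under conjugation by `S`, and transforming
under right translation by `L` according to `τ`. -/
def equivariantFunctions (L S : Subgroup G) (τ : G → ℂ) : Submodule ℂ (G → ℂ) where
  carrier := {f | (∀ g, g ∉ S → f g = 0) ∧ (∀ s ∈ S, ∀ g, f (s * g * s⁻¹) = f g) ∧
    ∀ x ∈ L, ∀ g, f (g * x) = τ x * f g}
  zero_mem' := by simp
  add_mem' := by
    rintro a b ⟨ha1, ha2, ha3⟩ ⟨hb1, hb2, hb3⟩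
    refine ⟨fun g hg => ?_, fun s hs g => ?_, fun x hx g => ?_⟩
    · simp [ha1 g hg, hb1 g hg]
    · simp [ha2 s hs, hb2 s hs]
    · simp [ha3 x hx, hb3 x hx, mul_add]
  smul_mem' := by
    rintro c a ⟨ha1, ha2, ha3⟩
    refine ⟨fun g hg => ?_, fun s hs g => ?_, fun x hx g => ?_⟩
    · simp [ha1 g hg]
    · simp [ha2 s hs]
    · simp only [Pi.smul_apply, smul_eq_mul, ha3 x hx]; ring

/-- Right convolution with the (unnormalized) idempotent of the linear character `τ` of `L`. -/
def convTau (L : Subgroup G) (τ : G → ℂ) : (G → ℂ) →ₗ[ℂ] (G → ℂ) where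
  toFun f g := ∑ x : L, τ (x : G)⁻¹ * f (g * x)
  map_add' f h := by ext g; simp [mul_add, Finset.sum_add_distrib]
  map_smul' c f := by
    ext g
    simp only [Pi.smul_apply, smul_eq_mul, RingHom.id_apply, Finset.mul_sum]
    exact Finset.sum_congr rfl fun _ _ => by ring

theorem convTau_apply (L : Subgroup G) (τ : G → ℂ) (f : G → ℂ) (g : G) :
    convTau L τ f g = ∑ x : L, τ (x : G)⁻¹ * f (g * x) := rfl

variable {L S : Subgroup G} {τ : G → ℂ}

theorem convTau_mul_right (hmul : ∀ x ∈ L, ∀ y ∈ L, τ (x * y) = τ x * τ y)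
    (f : G → ℂ) (g : G) {y : G} (hy : y ∈ L) :
    convTau L τ f (g * y) = τ y * convTau L τ f g := by
  simp only [convTau_apply, Finset.mul_sum]
  refine Fintype.sum_equiv (Equiv.mulLeft (⟨y, hy⟩ : L)) _ _ fun x => ?_
  have : τ (x : G)⁻¹ = τ y * τ ((x : G)⁻¹ * y⁻¹) := by
    rw [mul_comm, ← hmul _ (mul_mem (inv_mem x.2) (inv_mem hy)) _ hy, inv_mul_cancel_right]
  simp only [Equiv.coe_mulLeft, Subgroup.coe_mul, mul_inv_rev, ← mul_assoc]
  rw [this]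

/-- The operator of the (unnormalized) idempotent of `τ` on a representation. -/
def tauOp {V : Type} [AddCommGroup V] [Module ℂ V] (ρ : Representation ℂ G V)
    (L : Subgroup G) (τ : G → ℂ) : V →ₗ[ℂ] V :=
  ∑ x : L, τ (x : G)⁻¹ • ρ x

theorem isIdempotentElem_tauOp {V : Type} [AddCommGroup V] [Module ℂ V]
    (ρ : Representation ℂ G V) (hmul : ∀ x ∈ L, ∀ y ∈ L, τ (x * y) = τ x * τ y) :
    IsIdempotentElem ((Nat.card L : ℂ)⁻¹ • tauOp ρ L τ) := by
  have hsq : tauOp ρ L τ * tauOp ρ L τ = (Nat.card L : ℂ) • tauOp ρ L τ := by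
    have h1 : ∀ x : L, (τ (x : G)⁻¹ • ρ x) * tauOp ρ L τ = tauOp ρ L τ := by
      intro x
      simp only [tauOp, Finset.mul_sum]
      refine Fintype.sum_equiv (Equiv.mulLeft x) _ _ fun y => ?_
      simp only [Equiv.coe_mulLeft, Subgroup.coe_mul, mul_inv_rev, smul_mul_assoc, mul_smul_comm,
        map_mul, smul_smul]
      rw [mul_comm (τ _), hmul _ (inv_mem y.2) _ (inv_mem x.2)]
      congr 1
      ring
    conv_lhs => enter [1]; rw [tauOp]
    rw [Finset.sum_mul, Finset.sum_congr rfl fun x _ => h1 x]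
    rw [Finset.sum_const, Finset.card_univ, Nat.card_eq_fintype_card, Nat.cast_smul_eq_nsmul]
  have hL : (Nat.card L : ℂ) ≠ 0 := card_ne_zero'
  rw [IsIdempotentElem, smul_mul_smul_comm, hsq, smul_smul, mul_assoc, inv_mul_cancel₀ hL, mul_one]

theorem convTau_character {V : Type} [AddCommGroup V] [Module ℂ V]
    (ρ : Representation ℂ G V) (g : G) :
    convTau L τ ρ.character g = LinearMap.trace ℂ V (ρ g * tauOp ρ L τ) := by
  simp [convTau_apply, tauOp, Finset.mul_sum, ← map_mul, Representation.character]

theorem convTau_character_one_eq_nat {V : Type} [AddCommGroup V] [Module ℂ V]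
    [FiniteDimensional ℂ V] (ρ : Representation ℂ G V)
    (hmul : ∀ x ∈ L, ∀ y ∈ L, τ (x * y) = τ x * τ y) :
    ∃ n : ℕ, convTau L τ ρ.character 1 = n := by
  have hL : (Nat.card L : ℂ) ≠ 0 := card_ne_zero'
  have h := (LinearMap.IsIdempotentElem.isProj_range _ (isIdempotentElem_tauOp ρ hmul)).trace
  refine ⟨Nat.card L * Module.finrank ℂ
    (LinearMap.range ((Nat.card L : ℂ)⁻¹ • tauOp ρ L τ)), ?_⟩
  rw [Nat.cast_mul, ← h, convTau_character, map_one, one_mul, map_smul, smul_eq_mul,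
    mul_inv_cancel_left₀ hL]

theorem convTau_character_eq_zero {V : Type} [AddCommGroup V] [Module ℂ V]
    [FiniteDimensional ℂ V] (ρ : Representation ℂ G V)
    (hmul : ∀ x ∈ L, ∀ y ∈ L, τ (x * y) = τ x * τ y)
    (h0 : convTau L τ ρ.character 1 = 0) : convTau L τ ρ.character = 0 := by
  have hL : (Nat.card L : ℂ) ≠ 0 := card_ne_zero'
  have h1 : (Nat.card L : ℂ)⁻¹ • tauOp ρ L τ = 0 := by
    refine LinearMap.IsIdempotentElem.eq_zero_of_trace_eq_zero (isIdempotentElem_tauOp ρ hmul) ?_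
    rw [convTau_character, map_one, one_mul] at h0
    rw [map_smul, h0, smul_zero]
  have h2 : tauOp ρ L τ = 0 := (smul_eq_zero.1 h1).resolve_left (inv_ne_zero hL)
  funext g
  rw [convTau_character, h2, mul_zero, map_zero, Pi.zero_apply]

theorem exists_sum_convTau_eq {ψ : G → ℂ} (hψ : ψ ∈ Irr G) (h0 : convTau L τ ψ 1 ≠ 0) :
    ∃ ω : ℂ, ω ≠ 0 ∧ ∀ h, ∑ k : G, convTau L τ ψ (k⁻¹ * h * k) = ω * ψ h := by
  have hψ' := hψ
  obtain ⟨⟨V, rfl⟩, -⟩ := hψ'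
  let t : G → ℂ := fun g => if g ∈ L then τ g⁻¹ else 0
  let w : G → ℂ := fun g => ∑ k : G, t (k⁻¹ * g * k)
  have hw : ∀ g h, w (h * g * h⁻¹) = w g := by
    intro g h
    refine Fintype.sum_equiv (Equiv.mulLeft h⁻¹) _ _ fun k => ?_
    simp [mul_assoc]
  obtain ⟨ω, hω⟩ := weightedSum_eq_smul V.ρ hψ.2 hw
  have hconv : ∀ g, convTau L τ V.character g = ∑ x : G, t x * V.character (g * x) := by
    intro g
    simp only [convTau_apply, t, ite_mul, zero_mul]
    rw [← Finset.sum_filter]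
    exact (Finset.sum_subtype _ (by simp) fun x => τ x⁻¹ * V.character (g * x)).symm
  have key : ∀ h, ∑ k : G, convTau L τ V.character (k⁻¹ * h * k) = ω * V.character h := by
    intro h
    have htr := trace_weightedSum_mul V.ρ w h
    rw [hω, mul_smul_comm, mul_one, map_smul, smul_eq_mul] at htr
    refine Eq.trans ?_ htr.symm
    simp only [hconv, w, Finset.sum_mul]
    rw [Finset.sum_comm (s := Finset.univ) (t := Finset.univ)
      (f := fun g k => t (k⁻¹ * g * k) * _)]
    refine Finset.sum_congr rfl fun k _ => ?_
    refine Fintype.sum_equiv (MulAut.conj k).toEquiv _ _ fun x => ?_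
    have h1 : k⁻¹ * (k * x * k⁻¹) * k = x := by group
    have h2 : V.character (k⁻¹ * h * k * x) = V.character (h * (k * x * k⁻¹)) := by
      rw [← FDRep.char_conj V (k⁻¹ * h * k * x) k]
      congr 1
      group
    simp only [MulEquiv.toEquiv_eq_coe, EquivLike.coe_coe, MulAut.conj_apply, h1, h2]
    rfl
  refine ⟨ω, ?_, key⟩
  rintro rfl
  have := key 1
  simp only [mul_one, inv_mul_cancel, Finset.sum_const, zero_mul, smul_eq_zero] at this
  simp_all

theorem card_irr_over (hmul : ∀ x ∈ L, ∀ y ∈ L, τ (x * y) = τ x * τ y) (hone : τ 1 = 1)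
    (hS : ∀ s ∈ S, ∀ x ∈ L, s * x * s⁻¹ ∈ L ∧ τ (s * x * s⁻¹) = τ x)
    (hM : ∀ g, g ∉ S → ∃ y ∈ L, g * y * g⁻¹ ∈ L ∧ τ (g * y * g⁻¹) ≠ τ y) :
    Nat.card {ψ | ψ ∈ Irr G ∧ convTau L τ ψ 1 ≠ 0} =
      Module.finrank ℂ (equivariantFunctions L S τ) := by
  have hclass : ∀ ψ ∈ Irr G, ∀ g h, ψ (h * g * h⁻¹) = ψ g := by
    rintro ψ ⟨⟨V, rfl⟩, -⟩ g h
    rw [FDRep.char_conj]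
  have hmem : ∀ ψ ∈ Irr G, convTau L τ ψ ∈ equivariantFunctions L S τ := by
    intro ψ hψ
    have hinv : ∀ x ∈ L, τ x⁻¹ * τ x = 1 := fun x hx => by
      rw [← hmul _ (inv_mem hx) _ hx, inv_mul_cancel, hone]
    have hleft : ∀ x ∈ L, ∀ g, convTau L τ ψ (x * g) = τ x * convTau L τ ψ g := by
      intro x hx g
      simp only [convTau_apply, Finset.mul_sum]
      refine Fintype.sum_equiv (Equiv.mulRight (⟨x, hx⟩ : L)) _ _ fun y => ?_
      have h1 : τ (y : G)⁻¹ = τ x * τ (x⁻¹ * (y : G)⁻¹) := by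
        rw [← hmul _ hx _ (mul_mem (inv_mem hx) (inv_mem y.2)), mul_inv_cancel_left]
      have h2 : ψ (x * g * y) = ψ (g * (y * x)) := by
        rw [← hclass ψ hψ (x * g * y) x⁻¹]
        congr 1
        group
      simp only [Equiv.coe_mulRight, Subgroup.coe_mul, mul_inv_rev, h2]
      rw [h1]
      ring
    refine ⟨fun g hg => ?_, fun s hs g => ?_, fun x hx g => convTau_mul_right hmul ψ g hx⟩
    · obtain ⟨y, hy, hz, hne⟩ := hM g hg
      have h1 := hleft _ hz g
      rw [inv_mul_cancel_right, convTau_mul_right hmul ψ g hy] at h1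
      by_contra h0
      exact hne (mul_right_cancel₀ h0 h1).symm
    · have hconj : ∀ x : L, s * x * s⁻¹ ∈ L := fun x => (hS s hs x x.2).1
      have hconj' : ∀ x : L, s⁻¹ * x * s ∈ L := fun x => by
        simpa using (hS s⁻¹ (inv_mem hs) x x.2).1
      let e : L ≃ L :=
        { toFun := fun x => ⟨s⁻¹ * x * s, hconj' x⟩
          invFun := fun x => ⟨s * x * s⁻¹, hconj x⟩
          left_inv := fun x => Subtype.ext (by simp [mul_assoc])
          right_inv := fun x => Subtype.ext (by simp [mul_assoc]) }
      simp only [convTau_apply]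
      refine Fintype.sum_equiv e _ _ fun x => ?_
      have h1 : τ (s⁻¹ * x * s)⁻¹ = τ (x : G)⁻¹ := by
        have := (hS s⁻¹ (inv_mem hs) _ (inv_mem x.2)).2
        rw [← this]
        congr 1
        group
      have h2 : ψ (s * g * s⁻¹ * x) = ψ (g * (s⁻¹ * x * s)) := by
        rw [← hclass ψ hψ (s * g * s⁻¹ * x) s⁻¹]
        congr 1
        group
      simp only [e, Equiv.coe_fn_mk, h1, h2]
  let I : Set (G → ℂ) := {ψ | ψ ∈ Irr G ∧ convTau L τ ψ 1 ≠ 0}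
  let v : I → equivariantFunctions L S τ := fun ψ => ⟨convTau L τ ψ, hmem ψ ψ.2.1⟩
  have hli : LinearIndependent ℂ v := by
    rw [linearIndependent_iff']
    intro s c hc i hi
    choose ω hω0 hω using fun ψ : I => exists_sum_convTau_eq ψ.2.1 ψ.2.2
    have hc' : ∀ g, ∑ j ∈ s, c j * convTau L τ (j : G → ℂ) g = 0 := fun g => by
      have := congrFun (congrArg Subtype.val hc) g
      simpa [v] using this
    have h1 : ∀ h, ∑ j ∈ s, c j * ω j * (j : G → ℂ) h = 0 := by
      intro h
      simp only [mul_assoc, ← hω, Finset.mul_sum]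
      rw [Finset.sum_comm]
      simp only [← mul_assoc, hc', Finset.sum_const_zero]
    have h2 : ∑ j ∈ s, c j * ω j * innerG G (j : G → ℂ) i = 0 := by
      have : ∑ j ∈ s, c j * ω j * innerG G (j : G → ℂ) i =
          (Nat.card G : ℂ)⁻¹ * ∑ x : G, (∑ j ∈ s, c j * ω j * (j : G → ℂ) x) *
            (starRingEnd ℂ) ((i : G → ℂ) x) := by
        simp only [innerG_eq_sum, Finset.mul_sum, Finset.sum_mul]
        rw [Finset.sum_comm]
        exact Finset.sum_congr rfl fun _ _ => Finset.sum_congr rfl fun _ _ => by ring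
      simp [this, h1]
    rw [Finset.sum_eq_single_of_mem i hi, i.2.1.2, mul_one] at h2
    · exact (mul_eq_zero.1 h2).resolve_right (hω0 i)
    · intro j _ hj
      rw [innerG_irr j.2.1 i.2.1, if_neg fun h => hj (Subtype.ext h), mul_zero]
  have hsp : ⊤ ≤ Submodule.span ℂ (Set.range v) := by
    rintro ⟨f, hf⟩ -
    have ⟨hf1, hf2, hf3⟩ := hf
    let p : G → ℂ := fun g => ∑ k : G, f (k * g * k⁻¹)
    have hp : ∀ g h, p (h * g * h⁻¹) = p g := by
      intro g h
      refine Fintype.sum_equiv (Equiv.mulRight h) _ _ fun k => ?_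
      simp [mul_assoc]
    have hTp : convTau L τ p = ((Nat.card L : ℂ) * Nat.card S) • f := by
      funext g
      have h1 : convTau L τ p g =
          ∑ k : G, convTau L τ (fun a => f (k * a * k⁻¹)) g := by
        simp only [convTau_apply, p, Finset.mul_sum]
        rw [Finset.sum_comm]
      have h2 : ∀ k, convTau L τ (fun a => f (k * a * k⁻¹)) g =
          if k ∈ S then (Nat.card L : ℂ) * f g else 0 := by
        intro k
        split_ifs with hk
        · simp only [convTau_apply, hf2 k hk]
          have : ∀ x : L, τ (x : G)⁻¹ * f (g * x) = f g := fun x => by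
            rw [hf3 x x.2, ← mul_assoc, ← hmul _ (inv_mem x.2) _ x.2, inv_mul_cancel, hone,
              one_mul]
          simp [this, Nat.card_eq_fintype_card]
        · obtain ⟨y, hy, hz, hne⟩ := hM k hk
          have h4 : convTau L τ (fun a => f (k * a * k⁻¹)) g * τ (k * y * k⁻¹) =
              convTau L τ (fun a => f (k * a * k⁻¹)) g * τ y := by
            have h5 : ∀ a, f (k * (a * y) * k⁻¹) = τ (k * y * k⁻¹) * f (k * a * k⁻¹) := by
              intro a
              rw [← hf3 _ hz]
              congr 1
              group
            trans ∑ x : L, τ (x : G)⁻¹ * f (k * (g * x * y) * k⁻¹)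
            · simp only [h5, convTau_apply, Finset.sum_mul]
              exact Finset.sum_congr rfl fun _ _ => by ring
            · rw [convTau_apply, Finset.sum_mul]
              refine Fintype.sum_equiv (Equiv.mulRight (⟨y, hy⟩ : L)) _ _ fun x => ?_
              have h6 : τ (x : G)⁻¹ = τ y * τ (y⁻¹ * (x : G)⁻¹) := by
                rw [← hmul _ hy _ (mul_mem (inv_mem hy) (inv_mem x.2)), mul_inv_cancel_left]
              simp only [Equiv.coe_mulRight, Subgroup.coe_mul, mul_inv_rev, ← mul_assoc] at h6 ⊢
              rw [h6]
              ring
          by_contra h0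
          exact hne (mul_left_cancel₀ h0 h4)
      rw [h1, Finset.sum_congr rfl fun k _ => h2 k, ← Finset.sum_filter, Finset.sum_const,
        ← Fintype.card_subtype]
      simp [Nat.card_eq_fintype_card]
      ring
    have hW : ∀ q ∈ Submodule.span ℂ (Irr G), convTau L τ q ∈
        (Submodule.span ℂ (Set.range v)).map (equivariantFunctions L S τ).subtype := by
      intro q hq
      induction hq using Submodule.span_induction with
      | mem ψ hψ =>
        by_cases h0 : convTau L τ ψ 1 = 0
        · have hzero : convTau L τ ψ = 0 := by
            obtain ⟨⟨V, rfl⟩, -⟩ := hψ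
            exact convTau_character_eq_zero V.ρ hmul h0
          rw [hzero]
          exact zero_mem _
        · exact ⟨v ⟨ψ, hψ, h0⟩, Submodule.subset_span ⟨_, rfl⟩, rfl⟩
      | zero => rw [map_zero]; exact zero_mem _
      | add a b _ _ ha hb => rw [map_add]; exact add_mem ha hb
      | smul c a _ ha => rw [map_smul]; exact Submodule.smul_mem _ c ha
    have h0 : ((Nat.card L : ℂ) * Nat.card S) ≠ 0 := mul_ne_zero card_ne_zero' card_ne_zero'
    obtain ⟨a, ha, hab⟩ := hW p (class_mem_span_irr hp)
    rw [hTp] at hab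
    have : a = ((Nat.card L : ℂ) * Nat.card S) • ⟨f, hf⟩ :=
      Subtype.ext hab
    rw [this] at ha
    exact (Submodule.smul_mem_iff _ h0).1 ha
  exact (Module.finrank_eq_nat_card_basis (Module.Basis.mk hli hsp)).symm

end Over

/-! ### Algebra groups of nilpotent algebras -/

section AlgebraGroup

variable {J : NonUnitalSubalgebra F R}

theorem IsNil.isNilpotent (hJ : IsNil J) {x : R} (hx : x ∈ J) : IsNilpotent x := by
  obtain ⟨N, hN⟩ := hJ
  refine ⟨N, ?_⟩
  have := hN (List.replicate N x) (fun y hy => by rwa [List.eq_of_mem_replicate hy]) (by simp)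
  simpa using this

theorem pow_sub_one_mem {u : Rˣ} (hu : (u : R) - 1 ∈ J) (n : ℕ) :
    ((u ^ n : Rˣ) : R) - 1 ∈ J := by
  induction n with
  | zero => simp
  | succ n ih =>
    have h : ((u ^ (n + 1) : Rˣ) : R) - 1 =
        (((u ^ n : Rˣ) : R) - 1) * ((u : R) - 1) + (((u ^ n : Rˣ) : R) - 1) + ((u : R) - 1) := by
      rw [pow_succ]; push_cast; noncomm_ring
    rw [h]
    exact add_mem (add_mem (mul_mem ih hu) ih) hu

theorem mem_algGroup_iff {u : Rˣ} : u ∈ algGroup F R J ↔ (u : R) - 1 ∈ J := by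
  refine ⟨fun h => h.1, fun h => ⟨h, ?_⟩⟩
  have hinv : u⁻¹ = u ^ (orderOf u - 1) := by
    rw [inv_eq_iff_mul_eq_one, ← pow_succ', Nat.sub_add_cancel (orderOf_pos u), pow_orderOf_eq_one]
  rw [hinv]
  exact pow_sub_one_mem h _

theorem mem_algSubgroup_iff {k : NonUnitalSubalgebra F R} {g : algGroup F R J} :
    g ∈ algSubgroup k J ↔ ((g : Rˣ) : R) - 1 ∈ k := by
  rw [algSubgroup, Subgroup.mem_subgroupOf, mem_algGroup_iff]

theorem gElt_injective : Function.Injective (gElt : algGroup F R J → J) := by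
  intro g h hgh
  have : ((g : Rˣ) : R) - 1 = ((h : Rˣ) : R) - 1 := congrArg Subtype.val hgh
  exact Subtype.ext (Units.ext (sub_left_injective this))

theorem gElt_bijective (hJ : IsNil J) : Function.Bijective (gElt : algGroup F R J → J) := by
  refine ⟨gElt_injective, fun X => ?_⟩
  obtain ⟨u, hu⟩ := (hJ.isNilpotent X.2).isUnit_one_add
  have h : (u : R) - 1 = X := by rw [hu, add_sub_cancel_left]
  exact ⟨⟨u, mem_algGroup_iff.2 (h ▸ X.2)⟩, Subtype.ext h⟩

/-- The bijection `1 + X ↦ X` between the algebra group of a nilpotent algebra and the algebra. -/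
def gEltEquiv (hJ : IsNil J) : algGroup F R J ≃ J := Equiv.ofBijective gElt (gElt_bijective hJ)

theorem gEltEquiv_apply (hJ : IsNil J) (g : algGroup F R J) : gEltEquiv hJ g = gElt g := rfl

theorem coe_gEltEquiv_symm (hJ : IsNil J) (X : J) :
    (((gEltEquiv hJ).symm X : Rˣ) : R) = 1 + X := by
  have h : ((((gEltEquiv hJ).symm X : Rˣ) : R)) - 1 = X :=
    congrArg Subtype.val ((gEltEquiv hJ).apply_symm_apply X)
  rw [← h, add_sub_cancel]

theorem thetaFn_eq (θ : AddChar F ℂ) (lam : J →ₗ[F] F) (g : algGroup F R J) :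
    thetaFn θ J lam g = θ (lamE J lam (((g : Rˣ) : R) - 1)) := by
  rw [lamE_apply J lam g.2.1]
  rfl

theorem exists_addChar_mul_ne_one {θ : AddChar F ℂ} (hθ : θ ≠ 1) {a : F} (ha : a ≠ 0) :
    ∃ c : F, θ (c * a) ≠ 1 := by
  obtain ⟨b, hb⟩ := (AddChar.ne_one_iff).1 hθ
  exact ⟨b * a⁻¹, by rwa [inv_mul_cancel_right₀ ha]⟩

variable {lam : J →ₗ[F] F}

theorem conj_lone {s : algGroup F R J} (hs : s ∈ Sgrp J lam) {X : R} (hX : X ∈ lone J lam) :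
    ((s : Rˣ) : R) * X * ((s⁻¹ : algGroup F R J) : Rˣ) ∈ lone J lam ∧
      lamE J lam (((s : Rˣ) : R) * X * ((s⁻¹ : algGroup F R J) : Rˣ)) = lamE J lam X := by
  have h1 : ((s : Rˣ) : R) - 1 ∈ sone J lam := mem_algSubgroup_iff.1 hs
  have h2 : (((s⁻¹ : algGroup F R J) : Rˣ) : R) - 1 ∈ J := (s⁻¹).2.1
  set a := ((s : Rˣ) : R)
  set b := (((s⁻¹ : algGroup F R J) : Rˣ) : R)
  have h3 : X * (b - 1) ∈ lone J lam := lone_mul_mem J lam hX h2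
  have h4 : X + X * (b - 1) ∈ lone J lam := add_mem hX h3
  have h5 : (a - 1) * (X + X * (b - 1)) ∈ lone J lam := sone_mul_lone_mem J lam h1 h4
  have key : a * X * b = X + X * (b - 1) + (a - 1) * (X + X * (b - 1)) := by noncomm_ring
  rw [key]
  refine ⟨add_mem h4 h5, ?_⟩
  rw [lamE_add J lam (lone_le J lam h4) (lone_le J lam h5),
    lamE_add J lam (lone_le J lam hX) (lone_le J lam h3), h1.2 _ h4, hX.2 _ h2]
  ring

theorem exists_mul_mem_lone (hJ : IsNil J) {X : R} (hX : X ∈ J) (hXs : X ∉ sone J lam) :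
    ∃ Y ∈ lone J lam, X * Y ∈ lone J lam ∧ lamE J lam (X * Y) ≠ 0 := by
  by_contra! h
  obtain ⟨Y₀, hY₀, hne⟩ : ∃ Y ∈ lone J lam, lamE J lam (X * Y) ≠ 0 := by
    by_contra! h0
    exact hXs ⟨hX, h0⟩
  have key : ∀ n : ℕ, ∃ l : List R, (∀ x ∈ l, x ∈ J) ∧ l.length = n ∧
      Y₀ * l.prod ∈ lone J lam ∧ lamE J lam (X * (Y₀ * l.prod)) ≠ 0 := by
    intro n
    induction n with
    | zero => exact ⟨[], by simp, rfl, by simpa using hY₀, by simpa using hne⟩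
    | succ n ih =>
      obtain ⟨l, hl, hn, hY, hYne⟩ := ih
      have hnot : X * (Y₀ * l.prod) ∉ lone J lam := fun hm => hYne (h _ hY hm)
      obtain ⟨Z, hZ, hZne⟩ : ∃ Z ∈ J, lamE J lam (X * (Y₀ * l.prod) * Z) ≠ 0 := by
        by_contra! h0
        exact hnot ⟨mul_mem hX (lone_le J lam hY), h0⟩
      have hp : Y₀ * (l ++ [Z]).prod = Y₀ * l.prod * Z := by simp [mul_assoc]
      refine ⟨l ++ [Z], ?_, by simp [hn], ?_, ?_⟩
      · simp only [List.mem_append, List.mem_singleton]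
        rintro x (hx | rfl)
        exacts [hl x hx, hZ]
      · rw [hp]; exact lone_mul_mem J lam hY hZ
      · rwa [hp, ← mul_assoc X]
  obtain ⟨N, hN⟩ := hJ
  obtain ⟨l, hl, hn, -, hlne⟩ := key N
  apply hlne
  rw [hN l hl hn, mul_zero, mul_zero, lamE_zero]

theorem thetaFn_mul_of_mem_Lgrp (θ : AddChar F ℂ) {x : algGroup F R J} (hx : x ∈ Lgrp J lam)
    (y : algGroup F R J) :
    thetaFn θ J lam (x * y) = thetaFn θ J lam x * thetaFn θ J lam y := by
  have hx' : ((x : Rˣ) : R) - 1 ∈ lone J lam := mem_algSubgroup_iff.1 hx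
  have h : (((x * y : algGroup F R J) : Rˣ) : R) - 1 =
      (((x : Rˣ) : R) - 1) * (((y : Rˣ) : R) - 1) +
        ((((x : Rˣ) : R) - 1) + (((y : Rˣ) : R) - 1)) := by
    push_cast; noncomm_ring
  rw [thetaFn_eq, thetaFn_eq, thetaFn_eq, h, lamE_add J lam (mul_mem x.2.1 y.2.1)
    (add_mem x.2.1 y.2.1), lamE_add J lam x.2.1 y.2.1, hx'.2 _ y.2.1, zero_add,
    AddChar.map_add_eq_mul]

theorem thetaFn_one (θ : AddChar F ℂ) : thetaFn θ J lam 1 = 1 := by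
  rw [thetaFn_eq]
  simp [lamE_zero]

theorem coe_conj_sub_one (g y : algGroup F R J) :
    (((g * y * g⁻¹ : algGroup F R J) : Rˣ) : R) - 1 =
      ((g : Rˣ) : R) * (((y : Rˣ) : R) - 1) * ((g⁻¹ : algGroup F R J) : Rˣ) := by
  simp [mul_sub, sub_mul]

theorem conj_Lgrp (θ : AddChar F ℂ) {s x : algGroup F R J} (hs : s ∈ Sgrp J lam)
    (hx : x ∈ Lgrp J lam) : s * x * s⁻¹ ∈ Lgrp J lam ∧
      thetaFn θ J lam (s * x * s⁻¹) = thetaFn θ J lam x := by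
  have h := conj_lone hs (mem_algSubgroup_iff.1 hx)
  rw [← coe_conj_sub_one] at h
  exact ⟨mem_algSubgroup_iff.2 h.1, by rw [thetaFn_eq, thetaFn_eq, h.2]⟩

theorem exists_conj_ne_of_notMem_Sgrp (hJ : IsNil J) {θ : AddChar F ℂ} (hθ : θ ≠ 1)
    {g : algGroup F R J} (hg : g ∉ Sgrp J lam) :
    ∃ y ∈ Lgrp J lam, g * y * g⁻¹ ∈ Lgrp J lam ∧
      thetaFn θ J lam (g * y * g⁻¹) ≠ thetaFn θ J lam y := by
  obtain ⟨Y, hY, hXY, hne⟩ := exists_mul_mem_lone hJ g.2.1 (mt mem_algSubgroup_iff.2 hg)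
  obtain ⟨c, hc⟩ := exists_addChar_mul_ne_one hθ hne
  have hcY : c • Y ∈ lone J lam := SMulMemClass.smul_mem c hY
  have hcXY : (((g : Rˣ) : R) - 1) * c • Y ∈ lone J lam := by
    rw [mul_smul_comm]; exact SMulMemClass.smul_mem c hXY
  let y : algGroup F R J := (gEltEquiv hJ).symm ⟨c • Y, lone_le J lam hcY⟩
  have hy : ((y : Rˣ) : R) - 1 = c • Y := by
    rw [coe_gEltEquiv_symm, add_sub_cancel_left]
  set b := (((g⁻¹ : algGroup F R J) : Rˣ) : R)
  have hb : b - 1 ∈ J := (g⁻¹).2.1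
  have h4 : c • Y + (((g : Rˣ) : R) - 1) * c • Y ∈ lone J lam := add_mem hcY hcXY
  have h5 := lone_mul_mem J lam h4 hb
  have hgy : (((g * y * g⁻¹ : algGroup F R J) : Rˣ) : R) - 1 =
      (c • Y + (((g : Rˣ) : R) - 1) * c • Y) +
        (c • Y + (((g : Rˣ) : R) - 1) * c • Y) * (b - 1) := by
    rw [coe_conj_sub_one, hy]
    change _ * b = _
    generalize c • Y = Z
    noncomm_ring
  refine ⟨y, mem_algSubgroup_iff.2 (hy ▸ hcY), mem_algSubgroup_iff.2 ?_, ?_⟩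
  · rw [hgy]; exact add_mem h4 h5
  · rw [thetaFn_eq, thetaFn_eq, hgy, hy, lamE_add J lam (lone_le J lam h4) (lone_le J lam h5),
      h4.2 _ hb, add_zero, lamE_add J lam (lone_le J lam hcY) (lone_le J lam hcXY),
      mul_smul_comm, lamE_smul J lam c (lone_le J lam hXY), AddChar.map_add_eq_mul]
    intro h
    refine hc (mul_left_cancel₀ (a := θ (lamE J lam (c • Y))) ?_ (by rw [h, mul_one]))
    exact (θ.val_isUnit _).ne_zero

end AlgebraGroup

/-! ### The constituents of a supercharacter -/

section Constituents

variable {J : NonUnitalSubalgebra F R}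

theorem leftAct_leftAct (g h : algGroup F R J) (mu : J →ₗ[F] F) :
    leftAct g (leftAct h mu) = leftAct (g * h) mu := by
  ext X
  simp only [leftAct, LinearMap.comp_apply]
  congr 1
  ext
  simp [lmulMap, mul_assoc]

theorem rightAct_rightAct (g h : algGroup F R J) (mu : J →ₗ[F] F) :
    rightAct g (rightAct h mu) = rightAct (h * g) mu := by
  ext X
  simp only [rightAct, LinearMap.comp_apply]
  congr 1
  ext
  simp [rmulMap, mul_assoc]

theorem rightAct_leftAct (g h : algGroup F R J) (mu : J →ₗ[F] F) :
    rightAct g (leftAct h mu) = leftAct h (rightAct g mu) := by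
  ext X
  simp only [rightAct, leftAct, LinearMap.comp_apply]
  congr 1
  ext
  simp [rmulMap, lmulMap, mul_assoc]

theorem leftAct_one (mu : J →ₗ[F] F) : leftAct 1 mu = mu := by
  ext X
  simp only [leftAct, LinearMap.comp_apply]
  congr 1
  ext
  simp [lmulMap]

theorem rightAct_one (mu : J →ₗ[F] F) : rightAct 1 mu = mu := by
  ext X
  simp only [rightAct, LinearMap.comp_apply]
  congr 1
  ext
  simp [rmulMap]

theorem act_act (g g' h h' : algGroup F R J) (mu : J →ₗ[F] F) :
    leftAct g (rightAct h (leftAct g' (rightAct h' mu))) =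
      leftAct (g * g') (rightAct (h' * h) mu) := by
  rw [rightAct_leftAct, leftAct_leftAct, rightAct_rightAct]

variable {lam : J →ₗ[F] F}

theorem act_mem_twoOrbit (g h : algGroup F R J) {mu : J →ₗ[F] F} (hmu : mu ∈ twoOrbit J lam) :
    leftAct g (rightAct h mu) ∈ twoOrbit J lam := by
  obtain ⟨g', h', rfl⟩ := hmu
  exact ⟨_, _, act_act g g' h h' lam⟩

theorem sum_twoOrbit (Φ : (J →ₗ[F] F) → ℂ) :
    (Nat.card (algGroup F R J) : ℂ) ^ 2 * ∑ᶠ mu ∈ twoOrbit J lam, Φ mu =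
      Nat.card (twoOrbit J lam) *
        ∑ k : algGroup F R J, ∑ h : algGroup F R J, Φ (leftAct k (rightAct h lam)) := by
  have : Finite (J →ₗ[F] F) := DFunLike.finite _
  let T := (Set.toFinite (twoOrbit J lam)).toFinset
  have hT : ∀ {mu}, mu ∈ T ↔ mu ∈ twoOrbit J lam := by simp [T]
  have hcard : Nat.card (twoOrbit J lam) = T.card := by
    rw [Nat.card_coe_set_eq, Set.ncard_eq_toFinset_card _ (Set.toFinite (twoOrbit J lam))]
  have h1 : ∀ k h : algGroup F R J, ∑ mu ∈ T, Φ (leftAct k (rightAct h mu)) = ∑ mu ∈ T, Φ mu := by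
    intro k h
    refine Finset.sum_bij' (fun mu _ => leftAct k (rightAct h mu))
      (fun mu _ => leftAct k⁻¹ (rightAct h⁻¹ mu)) (fun mu hmu => hT.2 (act_mem_twoOrbit k h (hT.1 hmu)))
      (fun mu hmu => hT.2 (act_mem_twoOrbit _ _ (hT.1 hmu))) ?_ ?_ (fun _ _ => rfl)
    · intro mu _
      rw [act_act, inv_mul_cancel, mul_inv_cancel, rightAct_one, leftAct_one]
    · intro mu _
      rw [act_act, inv_mul_cancel, mul_inv_cancel, rightAct_one, leftAct_one]
  have h2 : ∀ mu ∈ T, ∑ k : algGroup F R J, ∑ h : algGroup F R J, Φ (leftAct k (rightAct h mu)) =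
      ∑ k : algGroup F R J, ∑ h : algGroup F R J, Φ (leftAct k (rightAct h lam)) := by
    intro mu hmu
    obtain ⟨g', h', rfl⟩ := hT.1 hmu
    refine Fintype.sum_equiv (Equiv.mulRight g') _ _ fun k => ?_
    refine Fintype.sum_equiv (Equiv.mulLeft h') _ _ fun h => ?_
    rw [act_act]
    rfl
  rw [finsum_mem_eq_finite_toFinset_sum _ (Set.toFinite _), hcard]
  calc (Nat.card (algGroup F R J) : ℂ) ^ 2 * ∑ mu ∈ T, Φ mu
      = ∑ k : algGroup F R J, ∑ h : algGroup F R J, ∑ mu ∈ T, Φ (leftAct k (rightAct h mu)) := by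
        simp only [h1, Finset.sum_const, Finset.card_univ, nsmul_eq_mul, Nat.card_eq_fintype_card]
        ring
    _ = ∑ mu ∈ T, ∑ k : algGroup F R J, ∑ h : algGroup F R J, Φ (leftAct k (rightAct h mu)) := by
        rw [Finset.sum_comm (s := T)]
        exact Finset.sum_congr rfl fun k _ => Finset.sum_comm
    _ = _ := by rw [Finset.sum_congr rfl h2, Finset.sum_const, nsmul_eq_mul]

theorem sum_addChar_linear {θ : AddChar F ℂ} (hθ : θ ≠ 1) {V : Type} [AddCommGroup V]
    [Module F V] [Fintype V] (f : V →ₗ[F] F) :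
    ∑ v : V, θ (f v) = if f = 0 then (Nat.card V : ℂ) else 0 := by
  have h := AddChar.sum_eq_ite (θ.compAddMonoidHom f.toAddMonoidHom)
  have hiff : θ.compAddMonoidHom f.toAddMonoidHom = 0 ↔ f = 0 := by
    constructor
    · intro h0
      ext v
      by_contra hv
      obtain ⟨c, hc⟩ := exists_addChar_mul_ne_one hθ hv
      apply hc
      have := DFunLike.congr_fun h0 (c • v)
      simpa using this
    · rintro rfl
      ext v
      simp
  simp only [hiff] at h
  rw [Nat.card_eq_fintype_card, ← h]
  rfl

/-- The bilinear form `(X, Y) ↦ λ(XY)`. -/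
def mulForm (lam : J →ₗ[F] F) : J →ₗ[F] J →ₗ[F] F := (LinearMap.mul F J).compr₂ lam

theorem mulForm_apply (lam : J →ₗ[F] F) (X Y : J) : mulForm lam X Y = lam (X * Y) := rfl

theorem mem_lone_iff {X : J} : (X : R) ∈ lone J lam ↔ mulForm lam X = 0 := by
  constructor
  · intro h
    ext Y
    have := h.2 Y Y.2
    rwa [lamE_apply J lam (mul_mem X.2 Y.2)] at this
  · intro h
    refine ⟨X.2, fun y hy => ?_⟩
    rw [lamE_apply J lam (mul_mem X.2 hy)]
    exact LinearMap.congr_fun h ⟨y, hy⟩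

theorem thetaFn_act (θ : AddChar F ℂ) (k h g : algGroup F R J) :
    thetaFn θ J (leftAct k (rightAct h lam)) g =
      thetaFn θ J (rightAct (h * k) lam) (k⁻¹ * g * k) := by
  simp only [thetaFn, leftAct, rightAct, LinearMap.comp_apply]
  congr 2
  ext
  simp [lmulMap, rmulMap, gElt, mul_sub, sub_mul, mul_assoc]

theorem sum_thetaFn_rightAct (hJ : IsNil J) {θ : AddChar F ℂ} (hθ : θ ≠ 1) (g : algGroup F R J) :
    ∑ h : algGroup F R J, thetaFn θ J (rightAct h lam) g =
      Nat.card (algGroup F R J) * if g ∈ Lgrp J lam then thetaFn θ J lam g else 0 := by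
  have h1 : ∑ h : algGroup F R J, thetaFn θ J (rightAct h lam) g =
      ∑ Y : J, thetaFn θ J lam g * θ (mulForm lam (gElt g) Y) := by
    refine Fintype.sum_equiv ((Equiv.inv _).trans (gEltEquiv hJ)) _ _ fun h => ?_
    rw [thetaFn, thetaFn, ← AddChar.map_add_eq_mul, mulForm_apply, ← map_add]
    simp only [rightAct, LinearMap.comp_apply]
    congr 2
    ext
    simp [rmulMap, gEltEquiv_apply, gElt, mul_sub]
  have h2 : g ∈ Lgrp J lam ↔ mulForm lam (gElt g) = 0 := by
    rw [← mem_lone_iff]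
    exact mem_algSubgroup_iff
  rw [h1, ← Finset.mul_sum, sum_addChar_linear hθ]
  simp only [h2, Nat.card_congr (gEltEquiv hJ)]
  split_ifs <;> ring

theorem innerG_superchar (hJ : IsNil J) {θ : AddChar F ℂ} (hθ : θ ≠ 1)
    {ψ : algGroup F R J → ℂ} (hψ : IsCharacter (algGroup F R J) ψ) :
    innerG (algGroup F R J) (superchar θ J lam) ψ =
      ((Nat.card (leftOrbit J lam) : ℂ) / Nat.card (algGroup F R J)) *
        convTau (Lgrp J lam) (thetaFn θ J lam) ψ 1 := by
  obtain ⟨V, rfl⟩ := hψ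
  have hG : (Nat.card (algGroup F R J) : ℂ) ≠ 0 := card_ne_zero'
  have : Finite (J →ₗ[F] F) := DFunLike.finite _
  have hO : (Nat.card (twoOrbit J lam) : ℂ) ≠ 0 := by
    have : Nonempty (twoOrbit J lam) := ⟨_, 1, 1, rfl⟩
    exact_mod_cast Nat.card_pos.ne'
  have h1 : ∀ g, (Nat.card (algGroup F R J) : ℂ) * superchar θ J lam g =
      Nat.card (leftOrbit J lam) * ∑ k : algGroup F R J,
        if k⁻¹ * g * k ∈ Lgrp J lam then thetaFn θ J lam (k⁻¹ * g * k) else 0 := by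
    intro g
    have h := sum_twoOrbit (lam := lam) fun mu => thetaFn θ J mu g
    have h2 : ∀ k : algGroup F R J, ∑ h : algGroup F R J,
        thetaFn θ J (leftAct k (rightAct h lam)) g = Nat.card (algGroup F R J) *
          if k⁻¹ * g * k ∈ Lgrp J lam then thetaFn θ J lam (k⁻¹ * g * k) else 0 := by
      intro k
      rw [← sum_thetaFn_rightAct hJ hθ]
      exact Fintype.sum_equiv (Equiv.mulRight k) _ _ fun h => thetaFn_act θ k h g
    rw [Finset.sum_congr rfl fun k _ => h2 k, ← Finset.mul_sum] at h
    rw [superchar]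
    refine mul_left_cancel₀ (mul_ne_zero hG hO) ?_
    rw [div_mul_eq_mul_div, mul_div_assoc', mul_assoc _ _ (_ / _), mul_div_cancel₀ _ hO]
    linear_combination (Nat.card (leftOrbit J lam) : ℂ) * h
  have h3 : (Nat.card (algGroup F R J) : ℂ) * ∑ g : algGroup F R J,
      superchar θ J lam g * (starRingEnd ℂ) (V.character g) =
      Nat.card (leftOrbit J lam) * (Nat.card (algGroup F R J) *
        convTau (Lgrp J lam) (thetaFn θ J lam) V.character 1) := by
    have h4 : ∀ k : algGroup F R J, ∑ g : algGroup F R J,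
        (if k⁻¹ * g * k ∈ Lgrp J lam then thetaFn θ J lam (k⁻¹ * g * k) else 0) *
          (starRingEnd ℂ) (V.character g) =
        convTau (Lgrp J lam) (thetaFn θ J lam) V.character 1 := by
      intro k
      have h5 : ∑ g : algGroup F R J,
          (if k⁻¹ * g * k ∈ Lgrp J lam then thetaFn θ J lam (k⁻¹ * g * k) else 0) *
            (starRingEnd ℂ) (V.character g) = ∑ g : algGroup F R J,
          if g ∈ Lgrp J lam then thetaFn θ J lam g⁻¹ * V.character g else 0 := by
        refine Fintype.sum_equiv ((MulAut.conj k⁻¹).toEquiv.trans (Equiv.inv _)) _ _ fun g => ?_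
        have h6 : V.character (k⁻¹ * g * k)⁻¹ = (starRingEnd ℂ) (V.character g) := by
          have h7 : (k⁻¹ * g * k)⁻¹ = k⁻¹ * g⁻¹ * k⁻¹⁻¹ := by group
          rw [h7, FDRep.char_conj]
          exact character_inv V.ρ g
        simp only [Equiv.trans_apply, MulEquiv.toEquiv_eq_coe, EquivLike.coe_coe, MulAut.conj_apply,
          inv_inv, Equiv.inv_apply, inv_mem_iff, h6, ite_mul, zero_mul]
      rw [h5, convTau_apply, ← Finset.sum_filter]
      simp only [one_mul]
      exact Finset.sum_subtype _ (by simp) fun x => thetaFn θ J lam x⁻¹ * V.character x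
    rw [Finset.mul_sum]
    simp only [← mul_assoc, h1]
    simp only [mul_assoc (Nat.card (leftOrbit J lam) : ℂ), ← Finset.mul_sum]
    congr 1
    simp only [Finset.sum_mul]
    rw [Finset.sum_comm, Finset.sum_congr rfl fun k _ => h4 k, Finset.sum_const, Finset.card_univ,
      nsmul_eq_mul, Nat.card_eq_fintype_card]
  rw [innerG_eq_sum]
  refine mul_left_cancel₀ (pow_ne_zero 2 hG) ?_
  rw [pow_two, mul_assoc, mul_inv_cancel_left₀ hG, h3]
  field_simp

theorem irrConstituents_superchar (hJ : IsNil J) {θ : AddChar F ℂ} (hθ : θ ≠ 1) :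
    IrrConstituents (algGroup F R J) (superchar θ J lam) =
      {ψ | ψ ∈ Irr (algGroup F R J) ∧ convTau (Lgrp J lam) (thetaFn θ J lam) ψ 1 ≠ 0} := by
  ext ψ
  refine and_congr_right fun hψ => ?_
  rw [innerG_superchar hJ hθ hψ.1]
  obtain ⟨⟨V, rfl⟩, -⟩ := hψ
  obtain ⟨n, hn⟩ := convTau_character_one_eq_nat (L := Lgrp J lam) (τ := thetaFn θ J lam) V.ρ
    fun x hx y _ => thetaFn_mul_of_mem_Lgrp θ hx y
  have : Finite (J →ₗ[F] F) := DFunLike.finite _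
  have h1 : 0 < Nat.card (leftOrbit J lam) := by
    have : Nonempty (leftOrbit J lam) := ⟨_, 1, rfl⟩
    exact Nat.card_pos
  have hpos : (0 : ℂ) < (Nat.card (leftOrbit J lam) : ℂ) / Nat.card (algGroup F R J) :=
    div_pos (by exact_mod_cast h1) (by exact_mod_cast Nat.card_pos)
  change 0 < _ * convTau _ _ (Representation.character V.ρ) 1 ↔
    convTau _ _ (Representation.character V.ρ) 1 ≠ 0
  rw [hn, mul_pos_iff_of_pos_left hpos, Nat.cast_pos, Nat.cast_ne_zero, Nat.pos_iff_ne_zero]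

end Constituents

/-! ### Fourier transform on a finite vector space -/

section Fourier

variable {W : Type} [AddCommGroup W] [Module F W] [Fintype W] [Fintype (W →ₗ[F] F)]

/-- The Fourier transform `c ↦ (X ↦ ∑ μ, c μ θ(μ X))`. -/
def fourier (θ : AddChar F ℂ) : ((W →ₗ[F] F) → ℂ) →ₗ[ℂ] (W → ℂ) where
  toFun c X := ∑ mu, c mu * θ (mu X)
  map_add' a b := by ext X; simp [add_mul, Finset.sum_add_distrib]
  map_smul' a b := by ext X; simp [Finset.mul_sum, mul_assoc]

theorem fourier_apply (θ : AddChar F ℂ) (c : (W →ₗ[F] F) → ℂ) (X : W) :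
    fourier θ c X = ∑ mu, c mu * θ (mu X) := rfl

theorem fourier_injective {θ : AddChar F ℂ} (hθ : θ ≠ 1) :
    Function.Injective (fourier (W := W) θ) := by
  rw [injective_iff_map_eq_zero]
  intro c hc
  funext mu
  have h1 : ∑ X : W, fourier θ c X * θ (-(mu X)) = c mu * Nat.card W := by
    simp only [fourier_apply, Finset.sum_mul]
    rw [Finset.sum_comm]
    have h2 : ∀ nu : W →ₗ[F] F, ∑ X : W, c nu * θ (nu X) * θ (-(mu X)) =
        c nu * if nu = mu then (Nat.card W : ℂ) else 0 := by
      intro nu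
      simp only [← sub_eq_zero (a := nu), ← sum_addChar_linear hθ, Finset.mul_sum]
      refine Finset.sum_congr rfl fun X _ => ?_
      rw [mul_assoc, ← AddChar.map_add_eq_mul, LinearMap.sub_apply, sub_eq_add_neg]
    rw [Finset.sum_congr rfl fun nu _ => h2 nu]
    simp
  have h3 : (Nat.card W : ℂ) ≠ 0 := by exact_mod_cast Nat.card_pos.ne'
  rw [hc] at h1
  simp only [Pi.zero_apply, zero_mul, Finset.sum_const_zero] at h1
  exact (mul_eq_zero.1 h1.symm).resolve_right h3

theorem fourier_surjective {θ : AddChar F ℂ} (hθ : θ ≠ 1) :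
    Function.Surjective (fourier (W := W) θ) := by
  have : FiniteDimensional F W := Module.Finite.of_finite
  have hcard : Fintype.card (W →ₗ[F] F) = Fintype.card W := by
    rw [← Nat.card_eq_fintype_card, ← Nat.card_eq_fintype_card,
      Module.natCard_eq_pow_finrank (K := F) (V := W),
      Module.natCard_eq_pow_finrank (K := F) (V := W →ₗ[F] F)]
    congr 1
    exact Subspace.dual_finrank_eq
  refine (LinearMap.injective_iff_surjective_of_finrank_eq_finrank ?_).1 (fourier_injective hθ)
  rw [Module.finrank_fintype_fun_eq_card, Module.finrank_fintype_fun_eq_card, hcard]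

end Fourier

/-! ### Coadjoint orbits of `S_λ` -/

section Orbits

variable {J : NonUnitalSubalgebra F R}

theorem coAct_coAct (g h : algGroup F R J) (mu : J →ₗ[F] F) :
    coAct g (coAct h mu) = coAct (h * g) mu := by
  ext X
  simp only [coAct, LinearMap.comp_apply]
  congr 1
  ext
  simp [rmulMap, lmulMap, mul_assoc]

theorem coAct_one (mu : J →ₗ[F] F) : coAct 1 mu = mu := by
  ext X
  simp only [coAct, LinearMap.comp_apply]
  congr 1
  ext
  simp [rmulMap, lmulMap]

theorem mem_coOrbit_self (mu : J →ₗ[F] F) : mu ∈ coOrbit J mu := ⟨1, coAct_one mu⟩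

theorem coOrbit_coAct (g : algGroup F R J) (mu : J →ₗ[F] F) :
    coOrbit J (coAct g mu) = coOrbit J mu := by
  ext nu
  constructor
  · rintro ⟨h, rfl⟩
    exact ⟨g * h, (coAct_coAct h g mu).symm⟩
  · rintro ⟨h, rfl⟩
    refine ⟨g⁻¹ * h, ?_⟩
    change coAct _ (coAct g mu) = coAct h mu
    rw [coAct_coAct, mul_inv_cancel_left]

variable (J) in
/-- The functions on the dual of `J` which are supported on `A` and constant on coadjoint orbits. -/
def orbitFunctions (A : Set (J →ₗ[F] F)) : Submodule ℂ ((J →ₗ[F] F) → ℂ) where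
  carrier := {c | (∀ mu, mu ∉ A → c mu = 0) ∧ ∀ g mu, c (coAct g mu) = c mu}
  zero_mem' := by simp
  add_mem' := by
    rintro a b ⟨ha1, ha2⟩ ⟨hb1, hb2⟩
    exact ⟨fun mu h => by simp [ha1 mu h, hb1 mu h], fun g mu => by simp [ha2, hb2]⟩
  smul_mem' := by
    rintro c a ⟨ha1, ha2⟩
    exact ⟨fun mu h => by simp [ha1 mu h], fun g mu => by simp [ha2]⟩

theorem finrank_orbitFunctions {A : Set (J →ₗ[F] F)} (hA : ∀ g, ∀ mu ∈ A, coAct g mu ∈ A) :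
    Module.finrank ℂ (orbitFunctions J A) = Nat.card (coOrbit J '' A) := by
  have : Finite (J →ₗ[F] F) := DFunLike.finite _
  have hmem : ∀ mu, coOrbit J mu ∈ coOrbit J '' A ↔ mu ∈ A := by
    refine fun mu => ⟨?_, Set.mem_image_of_mem _⟩
    rintro ⟨nu, hnu, h⟩
    obtain ⟨g, rfl⟩ : mu ∈ coOrbit J nu := h ▸ mem_coOrbit_self mu
    exact hA g nu hnu
  let P : ((coOrbit J '' A) → ℂ) →ₗ[ℂ] ((J →ₗ[F] F) → ℂ) :=
    { toFun := fun d mu => if h : coOrbit J mu ∈ coOrbit J '' A then d ⟨_, h⟩ else 0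
      map_add' := fun a b => by ext mu; dsimp; split_ifs <;> simp
      map_smul' := fun a b => by ext mu; dsimp; split_ifs <;> simp }
  have hP : ∀ d mu, P d mu = if h : coOrbit J mu ∈ coOrbit J '' A then d ⟨_, h⟩ else 0 :=
    fun _ _ => rfl
  have hinj : Function.Injective P := by
    intro d d' hd
    funext ⟨C, mu, hmu, hC⟩
    subst hC
    have := congrFun hd mu
    rwa [hP, hP, dif_pos ((hmem mu).2 hmu), dif_pos ((hmem mu).2 hmu)] at this
  have hrange : LinearMap.range P = orbitFunctions J A := by
    ext c
    constructor
    · rintro ⟨d, rfl⟩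
      refine ⟨fun mu hmu => ?_, fun g mu => ?_⟩
      · rw [hP, dif_neg (mt (hmem mu).1 hmu)]
      · simp only [hP, coOrbit_coAct]
    · rintro ⟨hc1, hc2⟩
      refine ⟨fun C => c C.2.choose, ?_⟩
      funext mu
      have hconst : ∀ nu, coOrbit J nu = coOrbit J mu → c nu = c mu := by
        intro nu hnu
        obtain ⟨g, rfl⟩ : mu ∈ coOrbit J nu := hnu ▸ mem_coOrbit_self mu
        exact (hc2 g nu).symm
      rw [hP]
      split_ifs with h
      · exact hconst _ h.choose_spec.2
      · exact (hc1 mu fun hmu => h ((hmem mu).2 hmu)).symm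
  have := Fintype.ofFinite (coOrbit J '' A)
  rw [← hrange, LinearMap.finrank_range_of_inj hinj, Module.finrank_fintype_fun_eq_card,
    Nat.card_eq_fintype_card]

end Orbits

section Restriction

variable {J : NonUnitalSubalgebra F R} {lam : J →ₗ[F] F}

theorem lone_le_sone : lone J lam ≤ sone J lam :=
  fun _ hx => ⟨lone_le J lam hx, fun y hy => hx.2 y (lone_le J lam hy)⟩

variable (J lam) in
/-- The functionals on `𝔰_λ` which agree with `λ` on `𝔩_λ`. -/
def agreeOnLone : Set (sone J lam →ₗ[F] F) :=
  {mu | ∀ Y : sone J lam, (Y : R) ∈ lone J lam → mu Y = lamE J lam Y}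

theorem image_resTo_rightOrbit (hJ : IsNil J) :
    resTo (sone_le J lam) '' rightOrbit J lam = agreeOnLone J lam := by
  ext mu
  constructor
  · rintro ⟨-, ⟨h, rfl⟩, rfl⟩ Y hY
    have h1 : (((h⁻¹ : algGroup F R J) : Rˣ) : R) - 1 ∈ J := (h⁻¹).2.1
    have h2 : (Y : R) * (((h⁻¹ : algGroup F R J) : Rˣ) : R) =
        Y + Y * ((((h⁻¹ : algGroup F R J) : Rˣ) : R) - 1) := by noncomm_ring
    have h3 := mul_mem (lone_le J lam hY) h1
    have h4 : lamE J lam ((Y : R) * (((h⁻¹ : algGroup F R J) : Rˣ) : R)) = lamE J lam Y := by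
      rw [h2, lamE_add J lam (lone_le J lam hY) h3, hY.2 _ h1, add_zero]
    rw [← h4, lamE_apply J lam (by rw [h2]; exact add_mem (lone_le J lam hY) h3)]
    rfl
  · intro hmu
    have : FiniteDimensional F J := Module.Finite.of_finite
    obtain ⟨r, hr⟩ := LinearMap.exists_leftInverse_of_injective (inclMap (sone_le J lam))
      (LinearMap.ker_eq_bot.2 fun X Y h => Subtype.ext (congrArg (fun Z : J => (Z : R)) h))
    have hr' : ∀ X, r (inclMap (sone_le J lam) X) = X := LinearMap.congr_fun hr
    have hann : mu.comp r - lam ∈ (LinearMap.ker (mulForm lam)).dualAnnihilator := by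
      rw [Submodule.mem_dualAnnihilator]
      intro X hX
      have hX' : (X : R) ∈ lone J lam := mem_lone_iff.2 hX
      have h1 : r X = ⟨X, lone_le_sone hX'⟩ := hr' ⟨X, lone_le_sone hX'⟩
      rw [LinearMap.sub_apply, LinearMap.comp_apply, h1, hmu _ hX', lamE_apply J lam X.2, sub_self]
    rw [← LinearMap.range_dualMap_eq_dualAnnihilator_ker] at hann
    obtain ⟨ξ, hξ⟩ := hann
    obtain ⟨Y, rfl⟩ := (Module.evalEquiv F J).surjective ξ
    have hY : ∀ X, lam (X * Y) = mu (r X) - lam X := fun X => LinearMap.congr_fun hξ X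
    refine ⟨_, ⟨((gEltEquiv hJ).symm Y)⁻¹, rfl⟩, ?_⟩
    ext X
    have h2 : rmulMap ((gEltEquiv hJ).symm Y) (inclMap (sone_le J lam) X) =
        inclMap (sone_le J lam) X + inclMap (sone_le J lam) X * Y := by
      ext
      simp [rmulMap, coe_gEltEquiv_symm, mul_add]
    change lam (rmulMap (((gEltEquiv hJ).symm Y)⁻¹)⁻¹ (inclMap (sone_le J lam) X)) = mu X
    rw [inv_inv, h2, map_add, hY, hr', add_sub_cancel]

theorem coAct_mem_agreeOnLone (u : algGroup F R (sone J lam)) {mu : sone J lam →ₗ[F] F}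
    (hmu : mu ∈ agreeOnLone J lam) : coAct u mu ∈ agreeOnLone J lam := by
  intro Y hY
  let s : algGroup F R J := ⟨u, mem_algGroup_iff.2 (sone_le J lam u.2.1)⟩
  have h := conj_lone (s := s) (mem_algSubgroup_iff.2 u.2.1) hY
  have h1 : ((lmulMap u (rmulMap u⁻¹ Y) : sone J lam) : R) =
      ((s : Rˣ) : R) * Y * ((s⁻¹ : algGroup F R J) : Rˣ) := by
    simp [s, lmulMap, rmulMap, mul_assoc]
  rw [← h.2, ← h1]
  exact hmu _ (h1 ▸ h.1)

end Restriction

section Equivariant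

variable {J : NonUnitalSubalgebra F R} {lam : J →ₗ[F] F}

/-- Extension by zero to the algebra group `1 + J` of the function `1 + X ↦ h X` on `1 + k`. -/
def extendAlg (k J : NonUnitalSubalgebra F R) : (k → ℂ) →ₗ[ℂ] (algGroup F R J → ℂ) where
  toFun h g := if hg : ((g : Rˣ) : R) - 1 ∈ k then h ⟨_, hg⟩ else 0
  map_add' a b := by ext g; dsimp; split_ifs <;> simp
  map_smul' a b := by ext g; dsimp; split_ifs <;> simp

theorem extendAlg_of_mem {k : NonUnitalSubalgebra F R} (h : k → ℂ) {g : algGroup F R J}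
    (hg : ((g : Rˣ) : R) - 1 ∈ k) : extendAlg k J h g = h ⟨_, hg⟩ := dif_pos hg

theorem extendAlg_of_notMem {k : NonUnitalSubalgebra F R} (h : k → ℂ) {g : algGroup F R J}
    (hg : g ∉ algSubgroup k J) : extendAlg k J h g = 0 :=
  dif_neg (mt mem_algSubgroup_iff.2 hg)

theorem extendAlg_injective (hJ : IsNil J) {k : NonUnitalSubalgebra F R} (hk : k ≤ J) :
    Function.Injective (extendAlg k J) := by
  intro a b hab
  funext X
  have h := congrFun hab ((gEltEquiv hJ).symm (inclMap hk X))
  have hX : ((((gEltEquiv hJ).symm (inclMap hk X) : algGroup F R J) : Rˣ) : R) - 1 = X := by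
    rw [coe_gEltEquiv_symm, add_sub_cancel_left]
    rfl
  have hX' := hX ▸ X.2
  rw [extendAlg_of_mem _ hX', extendAlg_of_mem _ hX'] at h
  simpa only [hX] using h

theorem exists_extendAlg_eq (hJ : IsNil J) {k : NonUnitalSubalgebra F R} (hk : k ≤ J)
    {f : algGroup F R J → ℂ} (hf : ∀ g, g ∉ algSubgroup k J → f g = 0) :
    ∃ h, extendAlg k J h = f := by
  refine ⟨fun X => f ((gEltEquiv hJ).symm (inclMap hk X)), ?_⟩
  funext g
  by_cases hg : g ∈ algSubgroup k J
  · rw [extendAlg_of_mem _ (mem_algSubgroup_iff.1 hg)]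
    congr 1
    rw [Equiv.symm_apply_eq]
    rfl
  · rw [extendAlg_of_notMem _ hg, hf g hg]

theorem mul_lone {s : algGroup F R J} (hs : s ∈ Sgrp J lam) {Y : R} (hY : Y ∈ lone J lam) :
    ((s : Rˣ) : R) * Y ∈ lone J lam ∧ lamE J lam (((s : Rˣ) : R) * Y) = lamE J lam Y := by
  have h1 : ((s : Rˣ) : R) - 1 ∈ sone J lam := mem_algSubgroup_iff.1 hs
  have h2 := sone_mul_lone_mem J lam h1 hY
  have h3 : ((s : Rˣ) : R) * Y = (((s : Rˣ) : R) - 1) * Y + Y := by noncomm_ring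
  rw [h3]
  refine ⟨add_mem h2 hY, ?_⟩
  rw [lamE_add J lam (lone_le J lam h2) (lone_le J lam hY), h1.2 Y hY, zero_add]

theorem extendAlg_mem_equivariantFunctions (hJ : IsNil J) (θ : AddChar F ℂ)
    (h : sone J lam → ℂ) :
    extendAlg (sone J lam) J h ∈
        equivariantFunctions (Lgrp J lam) (Sgrp J lam) (thetaFn θ J lam) ↔
      (∀ (u : algGroup F R (sone J lam)) X, h (lmulMap u (rmulMap u⁻¹ X)) = h X) ∧
      ∀ Y : sone J lam, (Y : R) ∈ lone J lam → ∀ X, h (X + Y) = θ (lamE J lam Y) * h X := by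
  have hS : ∀ X : sone J lam, ∃ g ∈ Sgrp J lam, ((g : Rˣ) : R) - 1 = X := by
    intro X
    have hX : ((((gEltEquiv hJ).symm (inclMap (sone_le J lam) X) : algGroup F R J) : Rˣ) : R) - 1
        = X := by
      rw [coe_gEltEquiv_symm, add_sub_cancel_left]
      rfl
    exact ⟨_, mem_algSubgroup_iff.2 (hX ▸ X.2), hX⟩
  have heval : ∀ (g : algGroup F R J) (X : sone J lam), ((g : Rˣ) : R) - 1 = X →
      extendAlg (sone J lam) J h g = h X := by
    intro g X hg
    rw [extendAlg_of_mem h (hg ▸ X.2)]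
    congr 1
    exact Subtype.ext hg
  have hconj : ∀ (u : algGroup F R (sone J lam)) (s g : algGroup F R J) (X : sone J lam),
      (u : Rˣ) = s → ((g : Rˣ) : R) - 1 = X →
      (((s * g * s⁻¹ : algGroup F R J) : Rˣ) : R) - 1 =
        (lmulMap u (rmulMap u⁻¹ X) : sone J lam) := by
    intro u s g X hu hg
    rw [coe_conj_sub_one, hg]
    simp [lmulMap, rmulMap, ← hu, mul_assoc]
  constructor
  · rintro ⟨-, h2, h3⟩
    refine ⟨fun u X => ?_, fun Y hY X => ?_⟩
    · obtain ⟨g, hg, hgX⟩ := hS X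
      let s : algGroup F R J := ⟨u, mem_algGroup_iff.2 (sone_le J lam u.2.1)⟩
      have := h2 s (mem_algSubgroup_iff.2 u.2.1) g
      rwa [heval _ _ (hconj u s g X rfl hgX), heval _ _ hgX] at this
    · obtain ⟨g, hg, hgX⟩ := hS X
      obtain ⟨hZ, hlZ⟩ := mul_lone (inv_mem hg) hY
      obtain ⟨x, hx, hxZ⟩ := hS ⟨_, lone_le_sone hZ⟩
      have hxZ' : ((x : Rˣ) : R) - 1 = ((g⁻¹ : algGroup F R J) : Rˣ) * (Y : R) := hxZ
      have hxL : x ∈ Lgrp J lam := mem_algSubgroup_iff.2 (hxZ' ▸ hZ)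
      have hgx : (((g * x : algGroup F R J) : Rˣ) : R) - 1 = (X + Y : sone J lam) := by
        have h4 : (((g * x : algGroup F R J) : Rˣ) : R) - 1 =
          (((g : Rˣ) : R) - 1) + ((g : Rˣ) : R) * (((x : Rˣ) : R) - 1) := by
          push_cast; noncomm_ring
        rw [h4, hgX, hxZ']
        simp
      have := h3 x hxL g
      rwa [heval _ _ hgx, heval _ _ hgX, thetaFn_eq, hxZ', hlZ] at this
  · rintro ⟨h1, h2⟩
    refine ⟨fun g hg => extendAlg_of_notMem h hg, fun s hs g => ?_, fun x hx g => ?_⟩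
    · by_cases hg : g ∈ Sgrp J lam
      · rw [heval g ⟨_, mem_algSubgroup_iff.1 hg⟩ rfl, ← h1 (toAlg ⟨s, hs⟩)]
        exact heval _ _ (hconj _ s g _ rfl rfl)
      · rw [extendAlg_of_notMem h hg, extendAlg_of_notMem h]
        intro hg'
        have := mul_mem (mul_mem (inv_mem hs) hg') hs
        exact hg (by simpa [mul_assoc] using this)
    · have hxS : x ∈ Sgrp J lam :=
        mem_algSubgroup_iff.2 (lone_le_sone (mem_algSubgroup_iff.1 hx))
      by_cases hg : g ∈ Sgrp J lam
      · obtain ⟨hZ, hlZ⟩ := mul_lone hg (mem_algSubgroup_iff.1 hx)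
        have h4 : (((g * x : algGroup F R J) : Rˣ) : R) - 1 =
          (((g : Rˣ) : R) - 1) + ((g : Rˣ) : R) * (((x : Rˣ) : R) - 1) := by
          push_cast; noncomm_ring
        rw [heval g ⟨_, mem_algSubgroup_iff.1 hg⟩ rfl, thetaFn_eq, ← hlZ,
          ← h2 ⟨_, lone_le_sone hZ⟩ hZ]
        exact heval _ _ h4
      · rw [extendAlg_of_notMem h hg, mul_zero, extendAlg_of_notMem h]
        exact fun hgx => hg ((Subgroup.mul_mem_cancel_right _ hxS).1 hgx)

theorem fourier_conditions {θ : AddChar F ℂ} (hθ : θ ≠ 1) [Fintype (sone J lam →ₗ[F] F)]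
    (c : (sone J lam →ₗ[F] F) → ℂ) :
    ((∀ (u : algGroup F R (sone J lam)) X,
        fourier θ c (lmulMap u (rmulMap u⁻¹ X)) = fourier θ c X) ∧
      ∀ Y : sone J lam, (Y : R) ∈ lone J lam → ∀ X,
        fourier θ c (X + Y) = θ (lamE J lam Y) * fourier θ c X) ↔
    c ∈ orbitFunctions (sone J lam) (agreeOnLone J lam) := by
  have h1 : ∀ (u : algGroup F R (sone J lam)) X, fourier θ c (lmulMap u (rmulMap u⁻¹ X)) =
      fourier θ (fun mu => c (coAct u⁻¹ mu)) X := by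
    intro u X
    rw [fourier_apply, fourier_apply]
    let e : (sone J lam →ₗ[F] F) ≃ (sone J lam →ₗ[F] F) :=
      { toFun := coAct u
        invFun := coAct u⁻¹
        left_inv := fun mu => by rw [coAct_coAct, mul_inv_cancel, coAct_one]
        right_inv := fun mu => by rw [coAct_coAct, inv_mul_cancel, coAct_one] }
    refine Fintype.sum_equiv e _ _ fun mu => ?_
    have h2 : coAct u⁻¹ (e mu) = mu := e.left_inv mu
    rw [h2]
    rfl
  have h2 : ∀ Y X, fourier θ c (X + Y) = fourier θ (fun mu => θ (mu Y) * c mu) X := by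
    intro Y X
    rw [fourier_apply, fourier_apply]
    refine Finset.sum_congr rfl fun mu _ => ?_
    rw [map_add, AddChar.map_add_eq_mul]
    ring
  have h3 : ∀ Y X, θ (lamE J lam Y) * fourier θ c X =
      fourier θ (fun mu => θ (lamE J lam Y) * c mu) X := by
    intro Y X
    rw [fourier_apply, fourier_apply, Finset.mul_sum]
    exact Finset.sum_congr rfl fun mu _ => by ring
  constructor
  · rintro ⟨ha, hb⟩
    refine ⟨fun mu hmu => ?_, fun u mu => ?_⟩
    · by_contra hc
      refine hmu fun Y hY => ?_
      by_contra hne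
      obtain ⟨a, hane⟩ := exists_addChar_mul_ne_one hθ (sub_ne_zero.2 hne)
      have haY : ((a • Y : sone J lam) : R) ∈ lone J lam := SMulMemClass.smul_mem a hY
      have h4 : (fun mu => θ (mu (a • Y)) * c mu) = fun mu => θ (lamE J lam (a • Y : R)) * c mu :=
        fourier_injective hθ (funext fun X => by rw [← h2, ← h3]; exact hb _ haY X)
      have h5 := mul_right_cancel₀ hc (congrFun h4 mu)
      rw [lamE_smul J lam a (lone_le J lam hY), map_smul, smul_eq_mul] at h5
      apply hane
      rw [mul_sub, sub_eq_add_neg, AddChar.map_add_eq_mul, h5, ← AddChar.map_add_eq_mul,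
        add_neg_cancel, AddChar.map_zero_eq_one]
    · have h4 : (fun mu => c (coAct u⁻¹⁻¹ mu)) = c :=
        fourier_injective hθ (funext fun X => by rw [← h1]; exact ha _ X)
      rw [inv_inv] at h4
      exact congrFun h4 mu
  · rintro ⟨ha, hb⟩
    refine ⟨fun u X => ?_, fun Y hY X => ?_⟩
    · rw [h1]
      simp only [hb]
    · rw [h2, h3]
      refine congrArg (fun d => fourier θ d X) (funext fun mu => ?_)
      by_cases hmu : mu ∈ agreeOnLone J lam
      · rw [hmu Y hY]
      · rw [ha mu hmu, mul_zero, mul_zero]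

theorem finrank_equivariantFunctions (hJ : IsNil J) {θ : AddChar F ℂ} (hθ : θ ≠ 1) :
    Module.finrank ℂ (equivariantFunctions (Lgrp J lam) (Sgrp J lam) (thetaFn θ J lam)) =
      Module.finrank ℂ (orbitFunctions (sone J lam) (agreeOnLone J lam)) := by
  have : Finite (sone J lam →ₗ[F] F) := DFunLike.finite _
  have := Fintype.ofFinite (sone J lam →ₗ[F] F)
  let T := extendAlg (sone J lam) J ∘ₗ fourier θ
  have hT : Function.Injective T :=
    (extendAlg_injective hJ (sone_le J lam)).comp (fourier_injective hθ)
  have hmap : (orbitFunctions (sone J lam) (agreeOnLone J lam)).map T =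
      equivariantFunctions (Lgrp J lam) (Sgrp J lam) (thetaFn θ J lam) := by
    have hiff : ∀ c, T c ∈ equivariantFunctions (Lgrp J lam) (Sgrp J lam) (thetaFn θ J lam) ↔
        c ∈ orbitFunctions (sone J lam) (agreeOnLone J lam) := fun c =>
      (extendAlg_mem_equivariantFunctions hJ θ _).trans (fourier_conditions hθ c)
    ext f
    constructor
    · rintro ⟨c, hc, rfl⟩
      exact (hiff c).2 hc
    · intro hf
      obtain ⟨h, rfl⟩ := exists_extendAlg_eq hJ (sone_le J lam) hf.1
      obtain ⟨c, rfl⟩ := fourier_surjective hθ h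
      exact ⟨c, (hiff c).1 hf, rfl⟩
  rw [← hmap]
  exact (Submodule.equivMapOfInjective T hT _).finrank_eq.symm

end Equivariant

theorem statement2 (F : Type) [Field F] [Fintype F]
    (R : Type) [Ring R] [Algebra F R] [Fintype R]
    (J : NonUnitalSubalgebra F R) (hJ : IsNil J)
    (θ : AddChar F ℂ) (hθ : θ ≠ 1)
    (lam : ↥J →ₗ[F] F) :
    Nat.card ↥(IrrConstituents ↥(algGroup F R J) (superchar θ J lam)) =
      Nat.card ↥{C : Set (↥(sone J lam) →ₗ[F] F) |
        ∃ ν ∈ rightOrbit J lam, C = coOrbit (sone J lam) (resTo (sone_le J lam) ν)} := by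
  have hset : {C : Set (↥(sone J lam) →ₗ[F] F) |
      ∃ ν ∈ rightOrbit J lam, C = coOrbit (sone J lam) (resTo (sone_le J lam) ν)} =
      coOrbit (sone J lam) '' agreeOnLone J lam := by
    rw [← image_resTo_rightOrbit hJ, Set.image_image]
    ext C
    simp only [Set.mem_ofPred_eq, Set.mem_image, eq_comm]
  rw [hset, irrConstituents_superchar hJ hθ,
    card_irr_over (S := Sgrp J lam) (fun x hx y _ => thetaFn_mul_of_mem_Lgrp θ hx y)
      (thetaFn_one θ) (fun s hs x hx => conj_Lgrp θ hs hx)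
      (fun g hg => exists_conj_ne_of_notMem_Sgrp hJ hθ hg),
    finrank_equivariantFunctions hJ hθ,
    finrank_orbitFunctions fun u _ hmu => coAct_mem_agreeOnLone u hmu]

end IterChar
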